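/- Let m, n, q be integers with m ≤ q ≤ n and suppose q = p^k is a prime power. Consider an m-layered cake and n agents with closed preferences (agent n being the 'birthday agent'). Then there exists a feasible and contiguous multi-division A = (A_1,…,A_q) of the m-layered cake into q layered pieces, obtained by q−1 long knives (i.e., every layer is cut at the same q−1 positions), such that for every j* ∈ [q] there is an assignment π : [n] → [q] with: π(n) = j*; for every i ∈ [n−1], π(i) ∈ c_i(A) (agent i is assigned one of her preferred layered pieces); and for every j ∈ [q], |π⁻¹(j)| ∈ {⌊n/q⌋, ⌈n/q⌉}. -/

import Mathlib

open MeasureTheory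

/-- A piece of cake: a finite union of closed subintervals of `[0,1]`. -/
def IsPiece (S : Set ℝ) : Prop :=
  ∃ I : Finset (ℝ × ℝ), (∀ p ∈ I, 0 ≤ p.1 ∧ p.2 ≤ 1) ∧ S = ⋃ p ∈ I, Set.Icc p.1 p.2

/-- A layered piece of the `m`-layered cake: one piece per layer. -/
def IsLayeredPiece {m : ℕ} (L : Fin m → Set ℝ) : Prop := ∀ ℓ, IsPiece (L ℓ)

/-- A contiguous layered piece: each component is a single (possibly empty or degenerate)
closed interval. -/
def IsContiguous {m : ℕ} (L : Fin m → Set ℝ) : Prop := ∀ ℓ, ∃ a b : ℝ, L ℓ = Set.Icc a b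

/-- A non-overlapping layered piece: pieces from different layers intersect in a finite set. -/
def IsNonOverlapping {m : ℕ} (L : Fin m → Set ℝ) : Prop :=
  ∀ ℓ ℓ', ℓ ≠ ℓ' → (L ℓ ∩ L ℓ').Finite

/-- A multi-division of the `m`-layered cake into `q` layered pieces: the pieces cover each
layer and have pairwise disjoint interiors (within each layer). -/
def IsMultiDivision {m q : ℕ} (A : Fin q → Fin m → Set ℝ) : Prop :=
  (∀ j, IsLayeredPiece (A j)) ∧
  (∀ ℓ, (⋃ j, A j ℓ) = Set.Icc (0 : ℝ) 1) ∧
  (∀ j j', j ≠ j' → ∀ ℓ, interior (A j ℓ) ∩ interior (A j' ℓ) = ∅)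

/-- The symmetric-difference pseudo-metric on layered pieces. -/
noncomputable def layeredDist {m : ℕ} (L L' : Fin m → Set ℝ) : ℝ :=
  ∑ ℓ, (volume (symmDiff (L ℓ) (L' ℓ))).toReal

/-- A multi-division into `q` layered pieces is obtained by `q − 1` long knives: there are cut
points `0 = x_0 ≤ x_1 ≤ … ≤ x_q = 1` such that, in every layer, the pieces are exactly the `q`
intervals determined by these cut points (one interval of each layer per piece). -/
def IsLongKnifeDivision {m q : ℕ} (A : Fin q → Fin m → Set ℝ) : Prop :=
  ∃ x : Fin (q + 1) → ℝ, Monotone x ∧ x 0 = 0 ∧ x (Fin.last q) = 1 ∧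
    ∃ σ : Fin m → Equiv.Perm (Fin q),
      ∀ ℓ j, A j ℓ = Set.Icc (x (Fin.castSucc (σ ℓ j))) (x (Fin.succ (σ ℓ j)))

/-! ### Chains of finite words -/

/-- Formal combinations of finite words; a word of length `n + 1` is an ordered `n`-simplex, and
the empty word spans the augmentation degree. -/
abbrev Chain (R α : Type*) [CommRing R] := List α →₀ R

namespace Chain

section Basic

variable {R : Type*} [CommRing R] {α β γ : Type*}

/-- The word `l`, as a chain. -/
noncomputable def of (R : Type*) [CommRing R] (l : List α) : Chain R α := Finsupp.single l 1

/-- The linear extension of a map defined on words. -/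
noncomputable def lift {M : Type*} [AddCommGroup M] [Module R M] (f : List α → M) :
    Chain R α →ₗ[R] M := Finsupp.linearCombination R f

@[simp] lemma lift_of {M : Type*} [AddCommGroup M] [Module R M] (f : List α → M) (l : List α) :
    lift f (of R l) = f l := by simp [lift, of]

lemma hom_ext {M : Type*} [AddCommGroup M] [Module R M] {f g : Chain R α →ₗ[R] M}
    (h : ∀ l, f (of R l) = g (of R l)) : f = g := by
  apply Finsupp.lhom_ext'
  intro l
  ext
  exact h l

/-- Map a function over all letters. -/
noncomputable def map (f : α → β) : Chain R α →ₗ[R] Chain R β := lift fun l => of R (l.map f)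

/-- Prepend a letter. -/
noncomputable def cons (a : α) : Chain R α →ₗ[R] Chain R α := lift fun l => of R (a :: l)

/-- The boundary of a word. -/
noncomputable def bdWord (R : Type*) [CommRing R] : List α → Chain R α
  | [] => 0
  | a :: l => of R l - cons a (bdWord R l)

/-- The boundary operator. -/
noncomputable def bd : Chain R α →ₗ[R] Chain R α := lift (bdWord R)

@[simp] lemma map_of (f : α → β) (l : List α) : map f (of R l) = of R (l.map f) := by simp [map]
@[simp] lemma cons_of (a : α) (l : List α) : cons a (of R l) = of R (a :: l) := by simp [cons]
@[simp] lemma bd_nil : bd (of R ([] : List α)) = 0 := by simp [bd, bdWord]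
lemma bd_of_cons (a : α) (l : List α) : bd (of R (a :: l)) = of R l - cons a (bd (of R l)) := by
  simp [bd, bdWord]

lemma bd_cons (a : α) (c : Chain R α) : bd (cons a c) = c - cons a (bd c) := by
  have : bd ∘ₗ cons (R := R) a = LinearMap.id - cons a ∘ₗ bd := hom_ext fun l => by
    simp [bd_of_cons]
  simpa using LinearMap.congr_fun this c

lemma map_cons (f : α → β) (a : α) (c : Chain R α) : map f (cons a c) = cons (f a) (map f c) := by
  have : map f ∘ₗ cons (R := R) a = cons (f a) ∘ₗ map f := hom_ext fun l => by simp
  simpa using LinearMap.congr_fun this c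

lemma map_map (f : α → β) (g : β → γ) (c : Chain R α) : map g (map f c) = map (g ∘ f) c := by
  have : map g ∘ₗ map (R := R) f = map (g ∘ f) := hom_ext fun l => by simp
  simpa using LinearMap.congr_fun this c

lemma map_id (c : Chain R α) : map id c = c := by
  have : map (R := R) (id : α → α) = LinearMap.id := hom_ext fun l => by simp
  simpa using LinearMap.congr_fun this c

lemma bd_bd (c : Chain R α) : bd (bd c) = 0 := by
  have : bd ∘ₗ bd (R := R) (α := α) = 0 := hom_ext fun l => by
    induction l with
    | nil => simp
    | cons a l ih =>
      simp only [LinearMap.comp_apply, LinearMap.zero_apply] at ih ⊢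
      simp [bd_of_cons, bd_cons, ih]
  simpa using LinearMap.congr_fun this c

lemma bd_map (f : α → β) (c : Chain R α) : bd (map f c) = map f (bd c) := by
  have : bd ∘ₗ map (R := R) f = map f ∘ₗ bd := hom_ext fun l => by
    induction l with
    | nil => simp
    | cons a l ih =>
      simp only [LinearMap.comp_apply, map_of] at ih ⊢
      simp [bd_of_cons, map_cons, ih]
  simpa using LinearMap.congr_fun this c

/-- Chains all of whose words lie in `S`. -/
abbrev On (R : Type*) [CommRing R] (S : Set (List α)) : Submodule R (Chain R α) :=
  Finsupp.supported R R S

lemma of_mem_on {S : Set (List α)} {l : List α} (h : l ∈ S) : of R l ∈ On R S :=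
  Finsupp.single_mem_supported _ _ h

lemma on_mono {S S' : Set (List α)} (h : S ⊆ S') : On R S ≤ On R S' := Finsupp.supported_mono h

lemma on_eq_span (S : Set (List α)) : On R S = Submodule.span R (of R '' S) :=
  Finsupp.supported_eq_span_single R S

lemma map_mem_of_on {M : Type*} [AddCommGroup M] [Module R M] {f : Chain R α →ₗ[R] M}
    {S : Set (List α)} {N : Submodule R M} (h : ∀ l ∈ S, f (of R l) ∈ N) {c : Chain R α}
    (hc : c ∈ On R S) : f c ∈ N := by
  rw [on_eq_span] at hc
  have : Submodule.span R (of R '' S) ≤ N.comap f := by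
    rw [Submodule.span_le]
    rintro _ ⟨l, hl, rfl⟩
    exact h l hl
  exact this hc

lemma eqOn_of_on {M : Type*} [AddCommGroup M] [Module R M] {f g : Chain R α →ₗ[R] M}
    {S : Set (List α)} (h : ∀ l ∈ S, f (of R l) = g (of R l)) {c : Chain R α}
    (hc : c ∈ On R S) : f c = g c := by
  have := map_mem_of_on (f := f - g) (N := ⊥) (by simpa [sub_eq_zero] using h) hc
  simpa [sub_eq_zero] using this

lemma mem_on_univ (c : Chain R α) : c ∈ On R (Set.univ : Set (List α)) := by
  simp

lemma cons_mem_on {a : α} {S S' : Set (List α)} (h : ∀ l ∈ S, a :: l ∈ S') {c : Chain R α}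
    (hc : c ∈ On R S) : cons a c ∈ On R S' :=
  map_mem_of_on (f := cons a) (fun l hl => by simpa using of_mem_on (h l hl)) hc

lemma map_mem_on {f : α → β} {S : Set (List α)} {S' : Set (List β)}
    (h : ∀ l ∈ S, l.map f ∈ S') {c : Chain R α} (hc : c ∈ On R S) : map f c ∈ On R S' :=
  map_mem_of_on (f := map f) (fun l hl => by simpa using of_mem_on (h l hl)) hc

/-- The boundary of a word consists of its sublists with one letter deleted. -/
lemma bd_of_mem_on (l : List α) :
    bd (of R l) ∈ On R {l' | l'.Sublist l ∧ l'.length + 1 = l.length} := by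
  induction l with
  | nil => simp
  | cons a l ih =>
    rw [bd_of_cons]
    refine Submodule.sub_mem _ (of_mem_on (by simp)) (cons_mem_on ?_ ih)
    rintro l' ⟨h1, h2⟩
    exact ⟨h1.cons_cons a, by simp [h2]⟩

lemma bd_mem_on {S S' : Set (List α)}
    (h : ∀ l ∈ S, ∀ l', l'.Sublist l → l'.length + 1 = l.length → l' ∈ S') {c : Chain R α}
    (hc : c ∈ On R S) : bd c ∈ On R S' :=
  map_mem_of_on (fun l hl => on_mono (fun l' hl' => h l hl l' hl'.1 hl'.2) (bd_of_mem_on l)) hc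

/-- Words of length `n`. -/
def len (α : Type*) (n : ℕ) : Set (List α) := {l | l.length = n}

lemma bd_mem_len {n : ℕ} {c : Chain R α} (hc : c ∈ On R (len α (n + 1))) :
    bd c ∈ On R (len α n) :=
  bd_mem_on (fun l hl l' _ h => by simp only [len, Set.mem_ofPred_eq] at *; omega) hc

lemma bd_sum_cons {B : Finset α} (b : α → Chain R α) :
    bd (∑ y ∈ B, cons y (b y)) = ∑ y ∈ B, b y - ∑ y ∈ B, cons y (bd (b y)) := by
  simp [map_sum, bd_cons]

lemma bd_mem_len_pred (l : List α) : bd (of R l) ∈ On R (len α (l.length - 1)) :=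
  on_mono (fun l' h => by have := h.2; simp only [len, Set.mem_ofPred_eq]; omega) (bd_of_mem_on l)

end Basic

section Acyclic

variable {R : Type*} [CommRing R] {α : Type*} [DecidableEq α]

/-- The part of a chain starting with the letter `x`, with that letter removed. -/
noncomputable def tail (x : α) : Chain R α →ₗ[R] Chain R α := lift fun l =>
  match l with
  | [] => 0
  | y :: t => if y = x then of R t else 0

lemma tail_cons (x y : α) (c : Chain R α) :
    tail x (cons y c) = if y = x then c else 0 := by
  have : tail (R := R) x ∘ₗ cons y = if y = x then LinearMap.id else 0 := hom_ext fun l => by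
    split_ifs with h <;> simp [tail, h]
  rw [← LinearMap.comp_apply, this]
  split_ifs <;> simp

lemma tail_mem_on {x : α} {S S' : Set (List α)} (h : ∀ t, x :: t ∈ S → t ∈ S') {c : Chain R α}
    (hc : c ∈ On R S) : tail x c ∈ On R S' := by
  refine map_mem_of_on (fun l hl => ?_) hc
  rcases l with _ | ⟨y, t⟩
  · simp [tail]
  · simp only [tail, lift_of]
    split_ifs with hy
    · subst hy
      exact of_mem_on (h t hl)
    · exact Submodule.zero_mem _

lemma sum_cons_tail {B : Finset α} {S : Set (List α)} (hS : ∀ l ∈ S, ∃ a t, l = a :: t ∧ a ∈ B)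
    {c : Chain R α} (hc : c ∈ On R S) : c = ∑ x ∈ B, cons x (tail x c) := by
  have := eqOn_of_on (f := LinearMap.id) (g := ∑ x ∈ B, cons x ∘ₗ tail x) (S := S) ?_ hc
  · simpa using this
  · intro l hl
    obtain ⟨a, t, rfl, ha⟩ := hS l hl
    simp only [LinearMap.id_apply, LinearMap.sum_apply, LinearMap.comp_apply]
    rw [Finset.sum_eq_single a]
    · simp [tail]
    · intro b _ hb
      simp [tail, hb.symm]
    · intro h; exact absurd ha h

/-- Words of length `n` without repetition over the alphabet `B`. -/
def inj (B : Finset α) (n : ℕ) : Set (List α) := {l | l.Nodup ∧ l.length = n ∧ ∀ a ∈ l, a ∈ B}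

/-- Injective words in which the letter `a` can only occur among the first `i` letters. -/
def injEarly (B : Finset α) (n : ℕ) (a : α) (i : ℕ) : Set (List α) :=
  {l | l ∈ inj B n ∧ a ∉ l.drop i}

lemma cons_mem_inj {B : Finset α} {n : ℕ} {x : α} {l : List α} :
    x :: l ∈ inj B (n + 1) ↔ x ∈ B ∧ l ∈ inj (B.erase x) n := by
  simp only [inj, Set.mem_ofPred_eq, List.nodup_cons, List.length_cons, List.mem_cons,
    forall_eq_or_imp, Finset.mem_erase, Nat.add_right_cancel_iff]
  constructor
  · rintro ⟨⟨h1, h2⟩, h3, h4, h5⟩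
    exact ⟨h4, h2, h3, fun a ha => ⟨fun h => h1 (h ▸ ha), h5 a ha⟩⟩
  · rintro ⟨h1, h2, h3, h4⟩
    exact ⟨⟨fun h => (h4 x h).1 rfl, h2⟩, h3, h1, fun a ha => (h4 a ha).2⟩

lemma inj_erase_subset (B : Finset α) (n : ℕ) (x : α) : inj (B.erase x) n ⊆ inj B n :=
  fun _ h => ⟨h.1, h.2.1, fun a ha => Finset.mem_of_mem_erase (h.2.2 a ha)⟩

/-- Every cycle of injective words over `B` below the top degree is a boundary. -/
def Fillable (R : Type*) [CommRing R] (B : Finset α) : Prop :=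
  ∀ n < B.card, ∀ c ∈ On R (inj B n), bd c = 0 → ∃ b ∈ On R (inj B (n + 1)), bd b = c

lemma cons_mem_injEarly {B : Finset α} {n i : ℕ} {a x : α} {l : List α} :
    x :: l ∈ injEarly B (n + 1) a (i + 1) ↔ x ∈ B ∧ l ∈ injEarly (B.erase x) n a i := by
  simp [injEarly, cons_mem_inj, and_assoc]

lemma exists_cons_of_mem_inj {B : Finset α} {n : ℕ} {l : List α} (hl : l ∈ inj B (n + 1)) :
    ∃ a t, l = a :: t ∧ a ∈ B := by
  rcases l with _ | ⟨y, t⟩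
  · exact absurd hl.2.1 (by simp)
  · exact ⟨y, t, rfl, (cons_mem_inj.1 hl).1⟩

lemma tail_bd_sum_cons {B : Finset α} {c : Chain R α} {x : α} (hx : x ∈ B)
    (hc : c = ∑ y ∈ B, cons y (tail y c)) :
    tail x (bd c) = ∑ y ∈ B, tail x (tail y c) - bd (tail x c) := by
  conv_lhs => rw [hc]
  simp only [map_sum, bd_cons, map_sub, tail_cons, Finset.sum_sub_distrib]
  simp [hx]

lemma sum_erase_cons_tail {B : Finset α} {c : Chain R α} {x : α} (hx : x ∈ B)
    (hc : c = ∑ y ∈ B, cons y (tail y c)) :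
    ∑ y ∈ B.erase x, cons y (tail y c) = c - cons x (tail x c) := by
  rw [eq_sub_iff_add_eq, Finset.sum_erase_add _ _ hx, ← hc]

lemma exists_bd_early {a : α} (i : ℕ) : ∀ (B : Finset α) (n : ℕ), a ∈ B → n < B.card →
    (∀ B' : Finset α, B' ⊂ B → Fillable R B') →
    ∀ c ∈ On R (injEarly B n a (i + 1)), bd c ∈ On R {l | a ∉ l.drop i} →
    ∃ b ∈ On R (injEarly B (n + 1) a (i + 1)), c - bd b ∈ On R (injEarly B n a i) := by
  induction i with
  | zero =>
    intro B n ha hn H c hc hbc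
    rcases n with _ | n
    · refine ⟨0, Submodule.zero_mem _, ?_⟩
      simp only [map_zero, sub_zero]
      refine on_mono ?_ hc
      rintro l ⟨hl, -⟩
      have := List.length_eq_zero_iff.1 hl.2.1
      subst this
      exact ⟨hl, by simp⟩
    have hsum := sum_cons_tail (fun l hl => exists_cons_of_mem_inj hl.1) hc
    have ht : ∀ x, tail x c ∈ On R (injEarly (B.erase x) n a 0) := fun x =>
      tail_mem_on (fun t h => (cons_mem_injEarly.1 h).2) hc
    have hfree : ∀ d : Chain R α, d ∈ On R {l | a ∉ l.drop 0} → tail a d = 0 := by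
      intro d hd
      have : tail a d ∈ On R (∅ : Set (List α)) := tail_mem_on (fun t h => by simp at h) hd
      simpa using this
    have hcyc : bd (tail a c) = 0 := by
      have := tail_bd_sum_cons ha hsum
      rw [hfree _ hbc, Finset.sum_eq_zero, zero_sub] at this
      · exact neg_eq_zero.1 this.symm
      · exact fun y _ => hfree _ (on_mono (fun l hl => hl.2) (ht y))
    obtain ⟨b, hb, hbb⟩ := H _ (Finset.erase_ssubset ha) n
      (by rw [Finset.card_erase_of_mem ha]; omega) _ (on_mono (fun l hl => hl.1) (ht a)) hcyc
    refine ⟨-cons a b, Submodule.neg_mem _ (cons_mem_on (fun l hl => ?_) hb), ?_⟩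
    · exact cons_mem_injEarly.2 ⟨ha, hl, fun h => by simpa using hl.2.2 a h⟩
    · have : c - bd (-cons a b) = ∑ x ∈ B.erase a, cons x (tail x c) + b := by
        rw [map_neg, bd_cons, hbb, sum_erase_cons_tail ha hsum]
        abel
      rw [this]
      refine Submodule.add_mem _ (Submodule.sum_mem _ fun x hx => ?_) (on_mono ?_ hb)
      · refine cons_mem_on (fun l hl => ?_) (ht x)
        refine ⟨cons_mem_inj.2 ⟨Finset.mem_of_mem_erase hx, hl.1⟩, ?_⟩
        have h1 : a ∉ l := by simpa using hl.2
        simp [h1, (Finset.ne_of_mem_erase hx).symm]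
      · intro l hl
        exact ⟨inj_erase_subset _ _ _ hl, fun h => by simpa using hl.2.2 a h⟩
  | succ i ih =>
    intro B n ha hn H c hc hbc
    rcases n with _ | n
    · refine ⟨0, Submodule.zero_mem _, ?_⟩
      simp only [map_zero, sub_zero]
      refine on_mono ?_ hc
      rintro l ⟨hl, -⟩
      have := List.length_eq_zero_iff.1 hl.2.1
      subst this
      exact ⟨hl, by simp⟩
    have hsum := sum_cons_tail (fun l hl => exists_cons_of_mem_inj hl.1) hc
    have ht : ∀ x, tail x c ∈ On R (injEarly (B.erase x) n a (i + 1)) := fun x =>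
      tail_mem_on (fun t h => (cons_mem_injEarly.1 h).2) hc
    have hb : ∀ x ∈ B.erase a, ∃ b ∈ On R (injEarly (B.erase x) (n + 1) a (i + 1)),
        tail x c - bd b ∈ On R (injEarly (B.erase x) n a i) := by
      intro x hx
      have hxB := Finset.mem_of_mem_erase hx
      refine ih (B.erase x) n (Finset.mem_erase.2 ⟨(Finset.ne_of_mem_erase hx).symm, ha⟩)
        (by rw [Finset.card_erase_of_mem hxB]; omega)
        (fun B' hB' => H B' (hB'.trans (Finset.erase_ssubset hxB))) _ (ht x) ?_
      have h1 := tail_bd_sum_cons hxB hsum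
      have h2 : bd (tail x c) = ∑ y ∈ B, tail x (tail y c) - tail x (bd c) := by
        rw [h1]; abel
      rw [h2]
      refine Submodule.sub_mem _ (Submodule.sum_mem _ fun y _ => ?_) ?_
      · exact tail_mem_on (fun t h => by simpa using h.2) (ht y)
      · exact tail_mem_on (fun t h => by simpa using h) hbc
    choose! b hb1 hb2 using hb
    refine ⟨-∑ x ∈ B.erase a, cons x (b x), Submodule.neg_mem _ (Submodule.sum_mem _ fun x hx =>
      cons_mem_on (fun l hl => ?_) (hb1 x hx)), ?_⟩
    · exact cons_mem_injEarly.2 ⟨Finset.mem_of_mem_erase hx, hl⟩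
    · have : c - bd (-∑ x ∈ B.erase a, cons x (b x)) = cons a (tail a c) +
          ∑ x ∈ B.erase a, cons x (tail x c - bd (b x)) + ∑ x ∈ B.erase a, b x := by
        rw [map_neg, bd_sum_cons]
        simp only [map_sub, Finset.sum_sub_distrib]
        rw [sum_erase_cons_tail ha hsum]
        abel
      rw [this]
      refine Submodule.add_mem _ (Submodule.add_mem _ (cons_mem_on (fun l hl => ?_) (ht a))
        (Submodule.sum_mem _ fun x hx => cons_mem_on (fun l hl => ?_) (hb2 x hx)))
        (Submodule.sum_mem _ fun x hx => on_mono ?_ (hb1 x hx))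
      · refine cons_mem_injEarly.2 ⟨ha, hl.1, fun h => ?_⟩
        simpa using hl.1.2.2 a (List.mem_of_mem_drop h)
      · exact cons_mem_injEarly.2 ⟨Finset.mem_of_mem_erase hx, hl⟩
      · exact fun l hl => ⟨inj_erase_subset _ _ _ hl.1, hl.2⟩

/-- The complex of injective words is acyclic below the top degree. -/
theorem fillable (B : Finset α) : Fillable R B := by
  induction B using Finset.strongInduction with
  | H B H =>
  intro n hn c hc hbc
  obtain ⟨a, ha⟩ : B.Nonempty := Finset.card_pos.1 (by omega)
  have key : ∀ i, ∃ b ∈ On R (inj B (n + 1)), c - bd b ∈ On R (injEarly B n a (n - i)) := by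
    intro i
    induction i with
    | zero =>
      refine ⟨0, Submodule.zero_mem _, ?_⟩
      simp only [map_zero, sub_zero, Nat.sub_zero]
      refine on_mono (S := inj B n) ?_ hc
      exact fun l hl => ⟨hl, by simp [hl.2.1.symm]⟩
    | succ i ih =>
      obtain ⟨b, hb, hcb⟩ := ih
      by_cases hi : n - i = 0
      · exact ⟨b, hb, by rwa [show n - (i + 1) = n - i by omega]⟩
      rw [show n - i = (n - (i + 1)) + 1 by omega] at hcb
      obtain ⟨b', hb', hcb'⟩ := exists_bd_early (n - (i + 1)) B n ha hn H _ hcb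
        (by rw [map_sub, hbc, bd_bd, sub_zero]; exact Submodule.zero_mem _)
      refine ⟨b + b', Submodule.add_mem _ hb (on_mono (fun l hl => hl.1) hb'), ?_⟩
      rwa [map_add, ← sub_sub]
  obtain ⟨b, hb, hcb⟩ := key n
  rw [Nat.sub_self] at hcb
  refine ⟨b + cons a (c - bd b), Submodule.add_mem _ hb (cons_mem_on (fun l hl => ?_) hcb), ?_⟩
  · refine cons_mem_inj.2 ⟨ha, hl.1.1, hl.1.2.1, fun x hx => Finset.mem_erase.2 ⟨?_, hl.1.2.2 x hx⟩⟩
    rintro rfl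
    exact hl.2 (by simpa using hx)
  · rw [map_add, bd_cons, map_sub, hbc, bd_bd]
    simp

end Acyclic

/-! ### Vandermonde products of words -/

section Vandermonde

variable {F : Type*} [Field F]

/-- The Vandermonde product of a word. -/
def vand : List F → F
  | [] => 1
  | x :: l => (l.map (· - x)).prod * vand l

lemma vand_nodup {l : List F} : vand l ≠ 0 ↔ l.Nodup := by
  induction l with
  | nil => simp [vand]
  | cons x l ih =>
    simp [vand, ih, List.prod_eq_zero_iff, sub_eq_zero]

lemma vand_shift (g : F) (l : List F) : vand (l.map (· + g)) = vand l := by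
  induction l with
  | nil => simp [vand]
  | cons x l ih =>
    simp only [List.map_cons, vand, ih, List.map_map]
    congr 3
    funext y
    simp

lemma vand_append (l l' : List F) :
    vand (l ++ l') = vand l * (l'.map fun y => (l.map fun x => y - x).prod).prod * vand l' := by
  induction l with
  | nil => simp [vand]
  | cons x l ih =>
    simp only [List.cons_append, vand, ih, List.map_append, List.prod_append, List.map_cons,
      List.prod_cons, List.prod_map_mul]
    ring

lemma vand_swap (C l : List F) (x y : F) :
    vand (C ++ x :: y :: l) = -vand (C ++ y :: x :: l) := by
  induction C with
  | nil =>
    simp only [List.nil_append, vand, List.map_cons, List.prod_cons]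
    ring
  | cons z C ih =>
    simp only [List.cons_append, vand, ih]
    rw [((List.Perm.swap y x l).append_left C).map (· - z) |>.prod_eq]
    ring

lemma vand_ofFn {n : ℕ} (v : Fin n → F) : vand (List.ofFn v) = (Matrix.vandermonde v).det := by
  rw [Matrix.det_vandermonde]
  induction n with
  | zero => simp [vand]
  | succ n ih =>
    rw [List.ofFn_succ, vand, ih, Fin.prod_univ_succ, Fin.prod_Ioi_zero, List.map_ofFn,
      List.prod_ofFn]
    simp [Fin.prod_Ioi_succ]

lemma bd_ofFn {R α : Type*} [CommRing R] {n : ℕ} (v : Fin (n + 1) → α) :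
    bd (of R (List.ofFn v)) =
      ∑ i : Fin (n + 1), (-1 : R) ^ (i : ℕ) • of R (List.ofFn (v ∘ i.succAbove)) := by
  induction n with
  | zero => simp [bd_of_cons, List.ofFn_succ]
  | succ n ih =>
    rw [List.ofFn_succ, bd_of_cons, ih, map_sum, sub_eq_add_neg, ← Finset.sum_neg_distrib,
      Fin.sum_univ_succ (n := n + 1)]
    congr 1
    · simp [Function.comp_def]
    · refine Finset.sum_congr rfl fun i _ => ?_
      rw [List.ofFn_succ (f := v ∘ i.succ.succAbove)]
      simp [Function.comp_def, pow_succ]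

variable {R : Type*} [CommRing R]

/-- Translation of all letters. -/
noncomputable def shift (g : F) : Chain R F →ₗ[R] Chain R F := map (· + g)

@[simp] lemma shift_of (g : F) (l : List F) : shift g (of R l) = of R (l.map (· + g)) := by
  simp [shift]

variable [Algebra R F]

/-- The linear extension of the Vandermonde product weighted by `w`. -/
noncomputable def wvand (R : Type*) [CommRing R] [Algebra R F] (w : F → F) : Chain R F →ₗ[R] F :=
  lift fun l => (l.map w).prod * vand l

lemma wvand_eq_zero (w : F → F) {c : Chain R F} (hc : c ∈ On R {l | ¬ l.Nodup}) :
    wvand R w c = 0 := by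
  have := map_mem_of_on (f := wvand R w) (N := ⊥) (fun l hl => ?_) hc
  · simpa using this
  · have : vand l = 0 := by
      by_contra h
      exact hl (vand_nodup.1 h)
    simp [wvand, this]

lemma wvand_shift (w : F → F) (g : F) (hw : ∀ y, w (y + g) = w y) (c : Chain R F) :
    wvand R w (shift g c) = wvand R w c := by
  have : wvand R w ∘ₗ shift g = wvand R w := hom_ext fun l => by
    simp [wvand, vand_shift, Function.comp_def, hw]
  simpa using LinearMap.congr_fun this c

lemma wvand_one_bd {n : ℕ} {c : Chain R F} (hc : c ∈ On R (len F (n + 2))) :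
    wvand R 1 (bd c) = 0 := by
  refine eqOn_of_on (f := wvand R 1 ∘ₗ bd) (g := 0) (fun l hl => ?_) hc
  obtain ⟨v, rfl⟩ : ∃ v : Fin (n + 2) → F, l = List.ofFn v := by
    have hl : l.length = n + 2 := hl
    exact ⟨fun i => l.get (i.cast hl.symm), List.ext_getElem (by rw [List.length_ofFn, hl])
      fun i h1 h2 => by rw [List.getElem_ofFn]; rfl⟩
  let M : Matrix (Fin (n + 2)) (Fin (n + 2)) F := fun i => Fin.cons 1 fun j => v i ^ (j : ℕ)
  have h0 : M.det = 0 := Matrix.det_zero_of_column_eq (i := 0) (j := 1) Fin.zero_ne_one (fun k => by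
    rw [← Fin.succ_zero_eq_one]
    simp only [M, Fin.cons_zero, Fin.cons_succ]
    simp)
  rw [Matrix.det_succ_column_zero] at h0
  simp only [LinearMap.comp_apply, LinearMap.zero_apply, bd_ofFn, map_sum]
  rw [← h0]
  refine Finset.sum_congr rfl fun i _ => ?_
  have h1 : M.submatrix i.succAbove Fin.succ = Matrix.vandermonde (v ∘ i.succAbove) := by
    ext a b
    rw [Matrix.submatrix_apply]
    simp only [M, Fin.cons_succ]
    rfl
  rw [h1, ← vand_ofFn]
  have h2 : ∀ l : List F, wvand R 1 (of R l) = vand l := fun l => by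
    simp [wvand, List.prod_eq_one]
  rcases Nat.even_or_odd (i : ℕ) with h | h <;> simp [h2, h.neg_one_pow, M]

end Vandermonde

/-! ### The shuffle with a periodic resolution -/

section Twist

variable {p : ℕ} [Fact p.Prime] {F : Type*} [Field F] [Algebra (ZMod p) F]

/-- Alternately the difference and the sum over the group generated by `b`. -/
noncomputable def twist (b : F) (j : ℕ) : Chain (ZMod p) F →ₗ[ZMod p] Chain (ZMod p) F :=
  if Even j then ∑ a : ZMod p, shift (a • b) else shift b - LinearMap.id

lemma twist_of_even {b : F} {j : ℕ} (hj : Even j) (c : Chain (ZMod p) F) :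
    twist b j c = ∑ a : ZMod p, shift (a • b) c := by
  simp [twist, hj]

lemma twist_of_odd {b : F} {j : ℕ} (hj : Odd j) (c : Chain (ZMod p) F) :
    twist b j c = shift b c - c := by
  simp [twist, Nat.not_even_iff_odd.2 hj]

lemma shift_shift {R : Type*} [CommRing R] (g h : F) (c : Chain R F) :
    shift h (shift g c) = shift (g + h) c := by
  rw [shift, shift, map_map, shift]
  congr 2
  funext x
  simp [add_assoc]

lemma shift_zero {R : Type*} [CommRing R] (c : Chain R F) : shift 0 c = c := by
  rw [shift, show (fun x : F => x + 0) = id by funext; simp, map_id]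

lemma sum_shift_smul (b : F) (c : Chain (ZMod p) F) :
    ∑ a : ZMod p, shift (b + a • b) c = ∑ a : ZMod p, shift (a • b) c := by
  refine Fintype.sum_equiv (Equiv.addRight 1) _ _ fun a => ?_
  rw [Equiv.coe_addRight, add_smul, one_smul, add_comm]

lemma twist_twist (b : F) (j : ℕ) (c : Chain (ZMod p) F) : twist b (j + 1) (twist b j c) = 0 := by
  rcases Nat.even_or_odd j with hj | hj
  · rw [twist_of_odd hj.add_one, twist_of_even hj, map_sum]
    simp only [shift_shift]
    simp_rw [add_comm _ b]
    rw [sum_shift_smul, sub_self]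
  · rw [twist_of_even hj.add_one, twist_of_odd hj]
    simp only [map_sub, shift_shift, Finset.sum_sub_distrib]
    rw [sum_shift_smul, sub_self]

lemma map_shift {R : Type*} [CommRing R] {f : F → F} {g g' : F} (hf : ∀ x, f (x + g) = f x + g')
    (c : Chain R F) :
    map f (shift g c) = shift g' (map f c) := by
  rw [shift, shift, map_map, map_map]
  congr 2
  funext x
  simp [hf]

lemma map_twist {f : F → F} {b b' : F} (hf : ∀ x (a : ZMod p), f (x + a • b) = f x + a • b')
    (j : ℕ) (c : Chain (ZMod p) F) : map f (twist b j c) = twist b' j (map f c) := by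
  rcases Nat.even_or_odd j with hj | hj
  · rw [twist_of_even hj, twist_of_even hj, map_sum]
    exact Finset.sum_congr rfl fun a _ => map_shift (fun x => hf x a) c
  · rw [twist_of_odd hj, twist_of_odd hj, map_sub, map_shift]
    exact fun x => by simpa using hf x 1

lemma bd_shift {R : Type*} [CommRing R] (g : F) (c : Chain R F) :
    bd (shift g c) = shift g (bd c) := bd_map _ c

lemma bd_twist (b : F) (j : ℕ) (c : Chain (ZMod p) F) : bd (twist b j c) = twist b j (bd c) := by
  rcases Nat.even_or_odd j with hj | hj
  · simp [twist_of_even hj, map_sum, bd_shift]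
  · simp [twist_of_odd hj, bd_shift]

lemma twist_mem_on {b : F} {S : Set (List F)}
    (hS : ∀ l ∈ S, ∀ a : ZMod p, l.map (· + a • b) ∈ S) (j : ℕ) {c : Chain (ZMod p) F}
    (hc : c ∈ On (ZMod p) S) : twist b j c ∈ On (ZMod p) S := by
  rcases Nat.even_or_odd j with hj | hj
  · rw [twist_of_even hj]
    exact Submodule.sum_mem _ fun a _ => map_mem_on (fun l hl => hS l hl a) hc
  · rw [twist_of_odd hj]
    exact Submodule.sub_mem _ (map_mem_on (fun l hl => by simpa using hS l hl 1) hc) hc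

/-- The signed shuffle of a word with the first `j` cells of the periodic resolution. -/
noncomputable def shuffle (b : F) : List F → ℕ → Chain (ZMod p) F
  | l, 0 => of _ l
  | [], _ + 1 => 0
  | h :: l, j + 1 =>
    cons h (shuffle b l (j + 1) + (-1 : ZMod p) ^ l.length • twist b (j + 1) (shuffle b (h :: l) j))
termination_by l j => (l, j)

lemma shuffle_zero (b : F) (l : List F) : shuffle (p := p) b l 0 = of _ l := by
  rw [shuffle]
lemma shuffle_nil (b : F) (j : ℕ) : shuffle (p := p) b [] (j + 1) = 0 := by
  rw [shuffle]
lemma shuffle_cons (b h : F) (l : List F) (j : ℕ) : shuffle (p := p) b (h :: l) (j + 1) =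
    cons h (shuffle b l (j + 1) +
      (-1 : ZMod p) ^ l.length • twist b (j + 1) (shuffle b (h :: l) j)) := by
  rw [shuffle]

/-- The linear extension of `shuffle`. -/
noncomputable def shuffleL (b : F) (j : ℕ) : Chain (ZMod p) F →ₗ[ZMod p] Chain (ZMod p) F :=
  lift fun l => shuffle b l j

@[simp] lemma shuffleL_of (b : F) (j : ℕ) (l : List F) :
    shuffleL b j (of (ZMod p) l) = shuffle b l j := by simp [shuffleL]

lemma shuffleL_zero (b : F) (c : Chain (ZMod p) F) : shuffleL b 0 c = c := by
  have : shuffleL (p := p) b 0 = LinearMap.id := hom_ext fun l => by simp [shuffle_zero]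
  simpa using LinearMap.congr_fun this c

lemma shuffleL_cons (b h : F) (j n : ℕ) {c : Chain (ZMod p) F} (hc : c ∈ On _ (len F n)) :
    shuffleL b (j + 1) (cons h c) = cons h (shuffleL b (j + 1) c +
      (-1 : ZMod p) ^ n • twist b (j + 1) (shuffleL b j (cons h c))) := by
  refine eqOn_of_on (f := shuffleL b (j + 1) ∘ₗ cons h) (g := cons h ∘ₗ (shuffleL b (j + 1) +
    (-1 : ZMod p) ^ n • (twist b (j + 1) ∘ₗ shuffleL b j ∘ₗ cons h))) (fun l hl => ?_) hc
  have hl : l.length = n := hl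
  simp [shuffle_cons, hl]

lemma map_shuffle {f : F → F} {b b' : F} (hf : ∀ x (a : ZMod p), f (x + a • b) = f x + a • b')
    (l : List F) (j : ℕ) : map f (shuffle (p := p) b l j) = shuffle b' (l.map f) j := by
  induction l, j using shuffle.induct with
  | case1 l => simp [shuffle_zero]
  | case2 j => simp [shuffle_nil]
  | case3 h l j ih1 ih2 =>
    rw [shuffle_cons, map_cons, map_add, map_smul, map_twist hf, ih1, ih2, List.map_cons,
      shuffle_cons, List.length_map]

lemma map_shuffleL {f : F → F} {b b' : F} (hf : ∀ x (a : ZMod p), f (x + a • b) = f x + a • b')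
    (j : ℕ) (c : Chain (ZMod p) F) : map f (shuffleL b j c) = shuffleL b' j (map f c) := by
  have : map f ∘ₗ shuffleL (p := p) b j = shuffleL b' j ∘ₗ map f := hom_ext fun l => by
    simp [map_shuffle hf]
  simpa using LinearMap.congr_fun this c

lemma bd_shuffle (b : F) (l : List F) (j : ℕ) : bd (shuffle (p := p) b l (j + 1)) =
    shuffleL b (j + 1) (bd (of _ l)) -
      (-1 : ZMod p) ^ l.length • twist b (j + 1) (shuffle b l j) := by
  induction l generalizing j with
  | nil =>
    rcases j with _ | j
    · simp [shuffle_nil, shuffle_zero, twist_of_odd]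
    · simp [shuffle_nil]
  | cons h l ihl =>
    have step : ∀ j, twist b (j + 1) (bd (shuffle (p := p) b (h :: l) j)) =
          twist b (j + 1) (shuffleL b j (bd (of _ (h :: l)))) →
        bd (shuffle (p := p) b (h :: l) (j + 1)) =
        shuffleL b (j + 1) (bd (of _ (h :: l))) + (-1 : ZMod p) ^ l.length •
          twist b (j + 1) (shuffle b (h :: l) j) := by
      intro j hT
      have hc : shuffleL b (j + 1) (cons h (bd (of (ZMod p) l))) =
          cons h (shuffleL b (j + 1) (bd (of (ZMod p) l)) - (-1 : ZMod p) ^ l.length •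
            twist b (j + 1) (shuffleL b j (cons h (bd (of (ZMod p) l))))) := by
        rcases l with _ | ⟨x, l⟩
        · simp
        · rw [shuffleL_cons b h j l.length (bd_mem_len_pred _), List.length_cons, pow_succ]
          simp
      rw [shuffle_cons, bd_cons, map_add, map_smul, bd_twist, hT, ihl, bd_of_cons, map_sub,
        map_sub, shuffleL_of, map_sub, hc, shuffleL_of]
      rw [smul_sub, sub_add_sub_cancel]
      abel
    have key : ∀ j, bd (shuffle (p := p) b (h :: l) (j + 1)) =
        shuffleL b (j + 1) (bd (of _ (h :: l))) + (-1 : ZMod p) ^ l.length •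
          twist b (j + 1) (shuffle b (h :: l) j) := by
      intro j
      induction j with
      | zero => exact step 0 (by rw [shuffle_zero, shuffleL_zero])
      | succ j ih => exact step _ (by rw [ih, map_add, map_smul, twist_twist, smul_zero, add_zero])
    rw [key]
    simp [pow_succ, sub_eq_add_neg]

end Twist

/-! ### Weighted Vandermonde products of shuffles -/

section WeightedShuffle

/-- Prepend a word. -/
noncomputable def app {R α : Type*} [CommRing R] (C : List α) : Chain R α →ₗ[R] Chain R α :=
  lift fun l => of R (C ++ l)

@[simp] lemma app_of {R α : Type*} [CommRing R] (C l : List α) :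
    app C (of R l) = of R (C ++ l) := by simp [app]

lemma app_cons {R α : Type*} [CommRing R] (C : List α) (h : α) (c : Chain R α) :
    app C (cons h c) = app (C ++ [h]) c := by
  have : app (R := R) C ∘ₗ cons h = app (C ++ [h]) := hom_ext fun l => by simp
  simpa using LinearMap.congr_fun this c

lemma app_nil {R α : Type*} [CommRing R] (c : Chain R α) : app [] c = c := by
  have : app (R := R) ([] : List α) = LinearMap.id := hom_ext fun l => by simp
  simpa using LinearMap.congr_fun this c

lemma app_mem_on {R α : Type*} [CommRing R] {C : List α} {S S' : Set (List α)}
    (h : ∀ l ∈ S, C ++ l ∈ S') {c : Chain R α} (hc : c ∈ On R S) : app C c ∈ On R S' :=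
  map_mem_of_on (f := app C) (fun l hl => by simpa using of_mem_on (h l hl)) hc

variable {p : ℕ} [hp : Fact p.Prime] {F : Type*} [Field F] [Algebra (ZMod p) F]

lemma shuffle_mem_head (b h : F) (l : List F) (j : ℕ) : shuffle (p := p) b (h :: l) j ∈
    On (ZMod p) {u | ∃ t, u = h :: t} := by
  rcases j with _ | j
  · rw [shuffle_zero]
    exact of_mem_on (show ∃ t, h :: l = h :: t from ⟨l, rfl⟩)
  · rw [shuffle_cons]
    exact cons_mem_on (S := Set.univ) (fun t _ => by exact ⟨t, rfl⟩) (mem_on_univ _)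

lemma twist_add_mul (b : F) (n j : ℕ) (c : Chain (ZMod p) F) :
    twist b (n * (p - 1) + j) c = twist b j c := by
  rcases hp.out.eq_two_or_odd' with rfl | hodd
  · have h : ∀ i, twist b i c = shift b c - c := fun i => by
      rcases Nat.even_or_odd i with hi | hi
      · have : (2 : ZMod 2) = 0 := rfl
        rw [twist_of_even hi, show (Finset.univ : Finset (ZMod 2)) = {0, 1} from rfl,
          Finset.sum_pair (zero_ne_one (α := ZMod 2)), zero_smul, one_smul, shift_zero, add_comm, sub_eq_add_neg,
          ← sub_eq_zero, add_sub_add_left_eq_sub, sub_neg_eq_add, ← two_smul (ZMod 2), this,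
          zero_smul]
      · exact twist_of_odd hi c
    rw [h, h]
  · have he : Even (n * (p - 1)) := (Nat.Odd.sub_odd hodd odd_one).mul_left n
    rcases Nat.even_or_odd j with hj | hj
    · rw [twist_of_even hj, twist_of_even (he.add hj)]
    · rw [twist_of_odd hj, twist_of_odd (he.add_odd hj)]

lemma apply_twist {M : Type*} [AddCommGroup M] [Module (ZMod p) M] {N : Type*} [AddCommGroup N]
    [Module (ZMod p) N] (φ : Chain (ZMod p) F →ₗ[ZMod p] M) (χ : Chain (ZMod p) F →ₗ[ZMod p] N)
    (f : N →+ M) {b : F} {x y : Chain (ZMod p) F}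
    (h : ∀ a : ZMod p, φ (shift (a • b) x) = f (χ (shift (a • b) y))) (j : ℕ) :
    φ (twist b j x) = f (χ (twist b j y)) := by
  rcases Nat.even_or_odd j with hj | hj
  · rw [twist_of_even hj, twist_of_even hj, map_sum, map_sum, map_sum]
    exact Finset.sum_congr rfl fun a _ => h a
  · have h0 := h 0
    have h1 := h 1
    rw [zero_smul, shift_zero, shift_zero] at h0
    rw [one_smul] at h1
    rw [twist_of_odd hj, twist_of_odd hj, map_sub, map_sub, map_sub, h0, h1]

lemma shift_shuffle (b : F) (a : ZMod p) (l : List F) (j : ℕ) :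
    shift (a • b) (shuffle (p := p) b l j) = shuffle b (l.map (· + a • b)) j :=
  map_shuffle (fun x c => by ring) l j

section Artin

variable [CharP F p]

/-- The additive polynomial whose roots are the multiples of `b`. -/
noncomputable def art (b : F) : F →ₗ[ZMod p] F :=
  (frobenius F p).toAddMonoidHom.toZModLinearMap p - LinearMap.mulLeft (ZMod p) (b ^ (p - 1))

lemma art_apply (b x : F) : art (p := p) b x = x ^ p - b ^ (p - 1) * x := by
  simp [art, frobenius_def]

lemma art_self (b : F) : art (p := p) b b = 0 := by
  rw [art_apply, ← pow_succ, Nat.sub_add_cancel hp.out.one_le, sub_self]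

lemma art_add_smul (b x : F) (a : ZMod p) : art (p := p) b (x + a • b) = art (p := p) b x := by
  rw [map_add, map_smul, art_self, smul_zero, add_zero]

lemma prod_sub_smul {b : F} (hb : b ≠ 0) (x : F) :
    ∏ a : ZMod p, (x - a • b) = art (p := p) b x := by
  have h1 : ∏ a : ZMod p, (Polynomial.X - Polynomial.C a) =
      (Polynomial.X ^ p - Polynomial.X : Polynomial (ZMod p)) := by
    have h := Polynomial.prod_multiset_X_sub_C_of_monic_of_roots_card_eq
      (p := (Polynomial.X ^ p - Polynomial.X : Polynomial (ZMod p)))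
      (Polynomial.monic_X_pow_sub (by simpa using hp.out.one_lt)) ?_
    · have h' := FiniteField.roots_X_pow_card_sub_X (ZMod p)
      rw [ZMod.card] at h'
      rwa [h'] at h
    · have h' := FiniteField.roots_X_pow_card_sub_X (ZMod p)
      rw [ZMod.card] at h'
      rw [h', FiniteField.X_pow_card_sub_X_natDegree_eq _ hp.out.one_lt]
      simp [ZMod.card]
  have h2 := congrArg (Polynomial.aeval (x / b)) h1
  simp only [map_prod, map_sub, Polynomial.aeval_X, Polynomial.aeval_C, map_pow] at h2
  have h3 : ∀ a : ZMod p, x - a • b = b * (x / b - algebraMap (ZMod p) F a) := fun a => by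
    rw [Algebra.smul_def]
    field_simp
  rw [Finset.prod_congr rfl fun a _ => h3 a, Finset.prod_mul_distrib, h2, art_apply]
  simp only [Finset.prod_const, Finset.card_univ, ZMod.card, mul_sub, div_pow]
  obtain ⟨r, rfl⟩ : ∃ r, p = r + 1 := ⟨p - 1, (Nat.sub_add_cancel hp.out.one_le).symm⟩
  simp only [Nat.add_sub_cancel]
  field_simp
  ring

end Artin

variable [DecidableEq F]

/-- The coset of the multiples of `b` through `h`. -/
def coset (p : ℕ) [Fact p.Prime] [Algebra (ZMod p) F] (b h : F) : Finset F :=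
  Finset.univ.image fun a : ZMod p => h + a • b

lemma card_coset_le (b h : F) : (coset p b h).card ≤ p :=
  Finset.card_image_le.trans (by simp [ZMod.card])

lemma mem_coset {b h y : F} : y ∈ coset p b h ↔ ∃ a : ZMod p, h + a • b = y := by
  simp [coset]

lemma mem_coset_add {b h y : F} (hy : y ∈ coset p b h) (a : ZMod p) :
    y + a • b ∈ coset p b h := by
  obtain ⟨c, rfl⟩ := mem_coset.1 hy
  exact mem_coset.2 ⟨c + a, by rw [add_smul, add_assoc]⟩

lemma mem_coset_shift {b h y : F} (hy : y ∈ coset p b h) (a : ZMod p) :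
    y ∈ coset p b (h + a • b) := by
  obtain ⟨c, rfl⟩ := mem_coset.1 hy
  exact mem_coset.2 ⟨c - a, by rw [sub_smul]; abel⟩

lemma self_mem_coset (b h : F) : h ∈ coset p b h := mem_coset.2 ⟨0, by simp⟩

lemma length_le_of_coset {b h : F} {l : List F} (hl : l.Nodup) (h1 : ∀ y ∈ l, y ∈ coset p b h) :
    l.length ≤ p := by
  rw [← List.toFinset_card_of_nodup hl]
  exact (Finset.card_le_card fun y hy => h1 y (List.mem_toFinset.1 hy)).trans (card_coset_le b h)

lemma shuffle_mem_on (b : F) (l : List F) (j : ℕ) : shuffle (p := p) b l j ∈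
    On (ZMod p) {u | u.length = l.length + j ∧ ∀ y ∈ u, ∃ h ∈ l, y ∈ coset p b h} := by
  induction l, j using shuffle.induct with
  | case1 l =>
    rw [shuffle_zero]
    exact of_mem_on ⟨rfl, fun y hy => ⟨y, hy, self_mem_coset b y⟩⟩
  | case2 j => rw [shuffle_nil]; exact Submodule.zero_mem _
  | case3 h l j ih1 ih2 =>
    rw [shuffle_cons, map_add, map_smul]
    refine Submodule.add_mem _ (cons_mem_on ?_ ih1)
      (Submodule.smul_mem _ _ (cons_mem_on ?_ (twist_mem_on ?_ _ ih2)))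
    · rintro u ⟨h1, h2⟩
      refine ⟨by simp [h1]; ring, ?_⟩
      simp only [List.mem_cons, forall_eq_or_imp, exists_eq_or_imp]
      exact ⟨Or.inl (self_mem_coset b h), fun y hy => Or.inr (h2 y hy)⟩
    · rintro u ⟨h1, h2⟩
      refine ⟨by simp [h1]; ring, ?_⟩
      simp only [List.mem_cons, forall_eq_or_imp, exists_eq_or_imp] at h2 ⊢
      exact ⟨Or.inl (self_mem_coset b h), h2⟩
    · rintro u ⟨h1, h2⟩ a
      refine ⟨by simp [h1], ?_⟩
      simp only [List.mem_map, forall_exists_index, and_imp, forall_apply_eq_imp_iff₂]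
      intro y hy
      obtain ⟨x, hx, hy⟩ := h2 y hy
      exact ⟨x, hx, mem_coset_add hy a⟩

lemma shuffle_mem_len (b : F) (l : List F) (j : ℕ) :
    shuffle (p := p) b l j ∈ On (ZMod p) (len F (l.length + j)) :=
  on_mono (fun _ h => And.left h) (shuffle_mem_on b l j)

lemma shuffle_mem_not_nodup (b : F) (l : List F) {j : ℕ} (hj : l.length * (p - 1) < j) :
    shuffle (p := p) b l j ∈ On (ZMod p) {u | ¬ u.Nodup} := by
  refine on_mono ?_ (shuffle_mem_on b l j)
  rintro u ⟨h1, h2⟩ h3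
  have h4 : u.toFinset ⊆ (l.toFinset.biUnion fun h => coset p b h) := by
    intro y hy
    obtain ⟨h, hh, hy⟩ := h2 y (List.mem_toFinset.1 hy)
    exact Finset.mem_biUnion.2 ⟨h, List.mem_toFinset.2 hh, hy⟩
  have h5 := (Finset.card_le_card h4).trans
    (Finset.card_biUnion_le_card_mul _ _ p fun h _ => card_coset_le b h)
  rw [List.toFinset_card_of_nodup h3, h1] at h5
  have h6 := Nat.mul_le_mul_right p (List.toFinset_card_le l)
  obtain ⟨r, rfl⟩ : ∃ r, p = r + 1 := ⟨p - 1, (Nat.sub_add_cancel hp.out.one_le).symm⟩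
  simp only [Nat.add_sub_cancel] at hj
  simp only [mul_add, mul_one] at h5 h6
  omega

variable [CharP F p]

lemma prod_sub_coset {b h : F} (hb : b ≠ 0) {C : List F} (hC : C.Nodup) (hl : C.length = p)
    (hCb : ∀ y ∈ C, y ∈ coset p b h) (y : F) :
    (C.map fun x => y - x).prod = art (p := p) b y - art (p := p) b h := by
  have h1 : C.toFinset = coset p b h := by
    refine Finset.eq_of_subset_of_card_le (fun y hy => hCb y (List.mem_toFinset.1 hy)) ?_
    rw [List.toFinset_card_of_nodup hC, hl]
    exact card_coset_le b h
  rw [← List.prod_toFinset _ hC, h1, coset, Finset.prod_image, ← map_sub, ← prod_sub_smul hb]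
  · exact Finset.prod_congr rfl fun a _ => by ring
  · intro a _ a' _ h
    exact smul_left_injective _ hb (add_left_cancel h)

lemma wvand_app_coset {b h : F} (hb : b ≠ 0) {C : List F} (hl : C.length = p)
    (hCb : ∀ y ∈ C, y ∈ coset p b h) {w : F → F} (hw : ∀ y (a : ZMod p), w (y + a • b) = w y)
    (c : Chain (ZMod p) F) : wvand (ZMod p) w (app C c) =
      w h ^ p * vand C *
        wvand (ZMod p) (fun y => w y * (art (p := p) b y - art (p := p) b h)) c := by
  have h1 : (C.map w).prod = w h ^ p := by
    rw [List.prod_eq_pow_card _ (w h), List.length_map, hl]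
    simp only [List.mem_map, forall_exists_index, and_imp, forall_apply_eq_imp_iff₂]
    intro y hy
    obtain ⟨a, rfl⟩ := mem_coset.1 (hCb y hy)
    exact hw h a
  have : wvand (ZMod p) w ∘ₗ app C = (w h ^ p * vand C) •
      wvand (ZMod p) (fun y => w y * (art (p := p) b y - art (p := p) b h)) :=
    hom_ext fun l => by
      simp only [LinearMap.comp_apply, app_of, LinearMap.smul_apply, wvand, lift_of, vand_append,
        List.map_append, List.prod_append, h1, smul_eq_mul, List.prod_map_mul]
      by_cases hC : C.Nodup
      · simp only [prod_sub_coset hb hC hl hCb]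
        ring
      · have : vand C = 0 := by
          by_contra h
          exact hC (vand_nodup.1 h)
        simp [this]
  simpa using LinearMap.congr_fun this c

lemma wvand_app_shuffle {b : F} (hb : b ≠ 0) {w : F → F} (hw : ∀ y (a : ZMod p), w (y + a • b) = w y)
    (t : ℕ) : ∀ (C : List F) (h : F) (l : List F), C.length + t + 1 = p →
    (∀ y ∈ C, y ∈ coset p b h) →
    wvand (ZMod p) w (app C (shuffle b (h :: l) (l.length * (p - 1) + t))) =
      ((-1) ^ l.length) ^ t * wvand (ZMod p) 1 (app C (shuffle b [h] t)) * w h ^ p *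
        wvand (ZMod p) (fun y => w y * (art (p := p) b y - art (p := p) b h))
          (shuffle b l (l.length * (p - 1))) := by
  have hCh : ∀ (C : List F) (h : F), (∀ y ∈ C, y ∈ coset p b h) →
      ∀ y ∈ C ++ [h], y ∈ coset p b h := by
    intro C h hC y hy
    rcases List.mem_append.1 hy with hy | hy
    · exact hC y hy
    · rw [List.mem_singleton.1 hy]
      exact self_mem_coset b h
  induction t with
  | zero =>
    intro C h l hC hCb
    have h1 : wvand (ZMod p) w (app C (shuffle b (h :: l) (l.length * (p - 1)))) =
        wvand (ZMod p) w (app (C ++ [h]) (shuffle b l (l.length * (p - 1)))) := by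
      rcases hJ : l.length * (p - 1) with _ | J
      · simp [shuffle_zero]
      · rw [shuffle_cons, app_cons, map_add, map_add, map_smul, map_smul,
          wvand_eq_zero w (c := app (C ++ [h]) (twist b (J + 1) _)), smul_zero, add_zero]
        refine app_mem_on (S := {u | ∃ y t, u = y :: t ∧ y ∈ coset p b h}) ?_
          (twist_mem_on ?_ _ (on_mono ?_ (shuffle_mem_head b h l J)))
        · rintro _ ⟨y, t, rfl, hy⟩ hn
          have hsub : (C ++ [h] ++ [y]).Sublist (C ++ [h] ++ y :: t) :=
            List.Sublist.append_left (by simp) _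
          have := length_le_of_coset (b := b) (h := h) (p := p) (hn.sublist hsub) (by
            intro z hz
            rcases List.mem_append.1 hz with hz | hz
            · exact hCh C h hCb z hz
            · rwa [List.mem_singleton.1 hz])
          simp at this
          omega
        · rintro _ ⟨y, t, rfl, hy⟩ a
          exact ⟨y + a • b, t.map (· + a • b), rfl, mem_coset_add hy a⟩
        · rintro _ ⟨t, rfl⟩
          exact ⟨h, t, rfl, self_mem_coset b h⟩
    rw [Nat.add_zero, h1, wvand_app_coset hb (by simpa using hC) (hCh C h hCb) hw, shuffle_zero]
    have : wvand (ZMod p) 1 (app C (of _ [h])) = vand (C ++ [h]) := by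
      simp [wvand, List.prod_eq_one]
    rw [this]
    ring
  | succ t ih =>
    intro C h l hC hCb
    have hnil : shuffle (p := p) b [h] (t + 1) = cons h (twist b (t + 1) (shuffle b [h] t)) := by
      rw [shuffle_cons, shuffle_nil]
      simp
    have hz : wvand (ZMod p) w (app (C ++ [h]) (shuffle b l (l.length * (p - 1) + t + 1))) = 0 := by
      refine wvand_eq_zero w (app_mem_on ?_ (shuffle_mem_not_nodup b l (by omega)))
      exact fun u hu hn => hu (hn.sublist (List.sublist_append_right _ _))
    have key := apply_twist (wvand (ZMod p) w ∘ₗ app (C ++ [h])) (wvand (ZMod p) 1 ∘ₗ app (C ++ [h]))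
      (AddMonoidHom.mulLeft (((-1) ^ l.length) ^ t * w h ^ p *
        wvand (ZMod p) (fun y => w y * (art (p := p) b y - art (p := p) b h))
          (shuffle b l (l.length * (p - 1))))) (b := b)
      (x := shuffle b (h :: l) (l.length * (p - 1) + t)) (y := shuffle b [h] t) (fun a => by
        have h2 := ih (C ++ [h]) (h + a • b) (l.map (· + a • b)) (by simp; omega)
          (fun y hy => mem_coset_shift (hCh C h hCb y hy) a)
        rw [List.length_map, ← shift_shuffle b a l, art_add_smul, hw, wvand_shift] at h2
        · rw [shift_shuffle, shift_shuffle]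
          simp only [LinearMap.comp_apply, List.map_cons, List.map_nil, h2,
            AddMonoidHom.coe_mulLeft]
          ring
        · intro y
          rw [hw, art_add_smul]) (t + 1)
    simp only [LinearMap.comp_apply, AddMonoidHom.coe_mulLeft] at key
    rw [hnil, ← add_assoc, shuffle_cons, app_cons, app_cons, map_add, map_add, hz, zero_add,
      map_smul, map_smul, add_assoc, twist_add_mul, key, Algebra.smul_def]
    simp only [map_pow, map_neg, map_one]
    ring

end WeightedShuffle

/-! ### Nonvanishing for a single line -/

section Line

/-- The concatenation of the pairs `x, x + 1`. -/
def pairs {R : Type*} [Ring R] (xs : List R) : List R := xs.flatMap fun x => [x, x + 1]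

@[simp] lemma pairs_nil {R : Type*} [Ring R] : pairs ([] : List R) = [] := rfl
@[simp] lemma pairs_cons {R : Type*} [Ring R] (x : R) (xs : List R) :
    pairs (x :: xs) = x :: (x + 1) :: pairs xs := rfl

lemma sublist_pairs {R : Type*} [Ring R] (xs : List R) : xs.Sublist (pairs xs) := by
  induction xs with
  | nil => rfl
  | cons x xs ih => exact (ih.cons _).cons_cons _

lemma length_pairs {R : Type*} [Ring R] (xs : List R) : (pairs xs).length = 2 * xs.length := by
  induction xs with
  | nil => rfl
  | cons x xs ih => simp [ih]; ring

variable {p : ℕ} {F : Type*} [Field F] [Algebra (ZMod p) F]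

lemma wvand_one_of (l : List F) : wvand (ZMod p) 1 (of _ l) = vand l := by
  simp [wvand, List.prod_eq_one]

variable [hp : Fact p.Prime]

lemma wvand_app_shuffle_line (b : F) (t : ℕ) : ∀ (C : List F) (h : ZMod p),
    wvand (ZMod p) 1 (app C (shuffle b [h • b] (2 * t))) =
      ∑ xs : Fin t → ZMod p, vand (C ++ (h :: pairs (List.ofFn xs)).map (· • b)) := by
  have hs : ∀ (j : ℕ) (h : F), shuffle (p := p) b [h] (j + 1) =
      cons h (twist b (j + 1) (shuffle b [h] j)) := by
    intro j h
    rw [shuffle_cons, shuffle_nil]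
    simp
  induction t with
  | zero =>
    intro C h
    simp [shuffle_zero, wvand_one_of]
  | succ t ih =>
    intro C h
    have h1 : ∀ x : ZMod p, wvand (ZMod p) 1 (app (C ++ [h • b]) (shuffle b [x • b] (2 * t + 1))) =
        ∑ xs : Fin t → ZMod p,
          vand (C ++ (h :: pairs (List.ofFn (Fin.cons x xs : Fin (t + 1) → ZMod p))).map (· • b)) := by
      intro x
      have hz : wvand (ZMod p) 1 (app (C ++ [h • b] ++ [x • b]) (shuffle b [x • b] (2 * t))) = 0 := by
        refine wvand_eq_zero _ (app_mem_on ?_ (shuffle_mem_head b _ _ _))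
        rintro _ ⟨u, rfl⟩
        simp [List.nodup_append]
      have hsh : shift b (shuffle (p := p) b [x • b] (2 * t)) =
          shuffle b [(x + 1) • b] (2 * t) := by
        have := shift_shuffle (p := p) b 1 [x • b] (2 * t)
        rw [one_smul] at this
        rw [this, add_smul, one_smul]
        rfl
      rw [hs, app_cons, twist_of_odd (by simp), map_sub, map_sub, hz, sub_zero, hsh, ih]
      refine Finset.sum_congr rfl fun xs _ => ?_
      simp [List.ofFn_succ]
    rw [show 2 * (t + 1) = 2 * t + 1 + 1 by ring, hs, app_cons,
      twist_of_even (by simp [parity_simps]), map_sum, map_sum,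
      ← (Fin.consEquiv fun _ => ZMod p).sum_comp, Fintype.sum_prod_type]
    simp only [shift_shuffle, List.map_cons, List.map_nil, ← add_smul]
    exact Fintype.sum_equiv (Equiv.addLeft h) _ _ fun a => h1 (h + a)

lemma vand_pairs_perm (b : F) {xs ys : List (ZMod p)} (hxy : xs.Perm ys) (C : List F) :
    vand (C ++ (pairs xs).map (· • b)) = vand (C ++ (pairs ys).map (· • b)) := by
  induction hxy generalizing C with
  | nil => rfl
  | cons x _ ih =>
    have := ih (C ++ [x • b, (x + 1) • b])
    simpa using this
  | swap x y l =>
    simp only [pairs_cons, List.map_cons]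
    generalize (pairs l).map (· • b) = u
    have h1 : ∀ a a' c c' : F, vand (C ++ a :: a' :: c :: c' :: u) =
        vand (C ++ c :: c' :: a :: a' :: u) := by
      intro a a' c c'
      have e1 := vand_swap (C ++ [a]) (c' :: u) a' c
      have e2 := vand_swap (C ++ [a, c]) u a' c'
      have e3 := vand_swap C (c' :: a' :: u) a c
      have e4 := vand_swap (C ++ [c]) (a' :: u) a c'
      simp only [List.append_assoc, List.cons_append, List.nil_append] at e1 e2 e3 e4
      rw [e1, e2, e3, e4]
      ring
    exact h1 _ _ _ _
  | trans _ _ ih1 ih2 => rw [ih1, ih2]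

lemma ne_add_one_of_nodup_pairs {R : Type*} [Ring R] {xs : List R} (hxs : (pairs xs).Nodup) {x y : R}
    (hx : x ∈ xs) (hy : y ∈ xs) : x ≠ y + 1 := by
  rw [pairs, List.nodup_flatMap] at hxs
  by_cases h : x = y
  · subst h
    have := hxs.1 x hx
    simp at this
    simpa using this
  · have hsymm : Std.Symm (Function.onFun List.Disjoint fun z : R => [z, z + 1]) :=
      ⟨fun _ _ h => h.symm⟩
    have := hxs.2.forall hx hy h
    rintro rfl
    exact this (a := y + 1) (by simp) (by simp)

lemma exists_odd_of_nodup_pairs {r : ℕ} (hr : p = 2 * r + 1) {xs : List (ZMod p)}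
    (hl : xs.length = r) (hn : (0 :: pairs xs).Nodup) {x : ZMod p} (hx : x ∈ xs) :
    ∃ i < r, x = (2 * i + 1 : ℕ) := by
  have hmem : ∀ y : ZMod p, y ∈ 0 :: pairs xs := by
    intro y
    have h1 : (0 :: pairs xs).toFinset = Finset.univ := by
      rw [← Finset.card_eq_iff_eq_univ, List.toFinset_card_of_nodup hn, ZMod.card]
      simp [length_pairs, hl, hr]
    exact List.mem_toFinset.1 (h1 ▸ Finset.mem_univ y)
  have hp0 : (pairs xs).Nodup := (List.nodup_cons.1 hn).2
  have hodd : ∀ m : ℕ, 2 * m < p → ((2 * m : ℕ) : ZMod p) ∉ xs := by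
    intro m
    induction m with
    | zero =>
      intro _ h
      refine (List.nodup_cons.1 hn).1 (List.mem_flatMap.2 ⟨0, by simpa using h, by simp⟩)
    | succ m ih =>
      intro hm h
      rcases List.mem_cons.1 (hmem ((2 * m + 1 : ℕ) : ZMod p)) with h0 | h0
      · rw [ZMod.natCast_eq_zero_iff] at h0
        exact absurd (Nat.le_of_dvd (by omega) h0) (by omega)
      · obtain ⟨y, hy, hy'⟩ := List.mem_flatMap.1 h0
        rcases List.mem_cons.1 hy' with h2 | h2
        · refine ne_add_one_of_nodup_pairs hp0 h hy ?_
          rw [← h2]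
          push_cast
          ring
        · have h3 := List.mem_singleton.1 h2
          have : y = ((2 * m : ℕ) : ZMod p) := by
            push_cast at h3 ⊢
            exact (add_right_cancel h3).symm
          exact ih (by omega) (this ▸ hy)
  have hlt := ZMod.val_lt x
  rcases Nat.even_or_odd' x.val with ⟨m, hm | hm⟩
  · exact absurd (by rwa [← hm, ZMod.natCast_zmod_val]) (hodd m (by omega))
  · exact ⟨m, by omega, by rw [← hm, ZMod.natCast_zmod_val]⟩

lemma range_eq_pairs (r : ℕ) : (List.range (2 * r + 1)).map (Nat.cast : ℕ → ZMod p) =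
    0 :: pairs (List.ofFn fun i : Fin r => ((2 * i + 1 : ℕ) : ZMod p)) := by
  induction r with
  | zero => simp
  | succ r ih =>
    rw [show 2 * (r + 1) + 1 = 2 * r + 1 + 1 + 1 by ring, List.range_succ, List.range_succ,
      List.map_append, List.map_append, ih, List.ofFn_succ']
    simp [pairs, List.concat_eq_append, add_assoc, one_add_one_eq_two]

variable [CharP F p]

lemma wvand_shuffle_zero_ne_zero {b : F} (hb : b ≠ 0) :
    wvand (ZMod p) 1 (shuffle b [0] (p - 1)) ≠ 0 := by
  rcases hp.out.eq_two_or_odd' with rfl | ⟨r, hr⟩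
  · rw [shuffle_cons, shuffle_nil, shuffle_zero, twist_of_odd (by simp)]
    simp [wvand_one_of, vand, hb]
  have hinj : Function.Injective fun i : Fin r => ((2 * i + 1 : ℕ) : ZMod p) := by
    intro i j hij
    have := (ZMod.natCast_eq_natCast_iff' _ _ _).1 hij
    rw [Nat.mod_eq_of_lt (by omega), Nat.mod_eq_of_lt (by omega)] at this
    exact Fin.ext (by omega)
  have h1 := wvand_app_shuffle_line (p := p) b r [] 0
  rw [app_nil, zero_smul, show 2 * r = p - 1 by omega] at h1
  rw [h1]
  have h2 := Finset.sum_of_injOn (s := Finset.univ) (t := Finset.univ)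
    (f := fun σ : Equiv.Perm (Fin r) => vand
      ((0 :: pairs (List.ofFn fun i : Fin r => ((2 * i + 1 : ℕ) : ZMod p))).map (· • b)))
    (g := fun xs : Fin r → ZMod p => vand ([] ++ (0 :: pairs (List.ofFn xs)).map (· • b)))
    (fun σ i => ((2 * σ i + 1 : ℕ) : ZMod p)) ?_ (by simp) ?_ ?_
  · rw [← h2, Finset.sum_const, Finset.card_univ, Fintype.card_perm, Fintype.card_fin,
      nsmul_eq_mul]
    refine mul_ne_zero ?_ (vand_nodup.2 ?_)
    · rw [Ne, CharP.cast_eq_zero_iff F p, hp.out.dvd_factorial]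
      omega
    · rw [← range_eq_pairs, List.map_map]
      refine List.Nodup.map_on (fun i hi j hj hij => ?_) List.nodup_range
      rw [List.mem_range] at hi hj
      have := (ZMod.natCast_eq_natCast_iff' _ _ _).1 (smul_left_injective _ hb hij)
      rwa [Nat.mod_eq_of_lt (by omega), Nat.mod_eq_of_lt (by omega)] at this
  · intro σ _ τ _ h
    ext i
    exact congrArg Fin.val (hinj (congrFun h i))
  · intro xs _ hxs
    by_contra h
    refine hxs ?_
    have hn := vand_nodup.1 h
    rw [List.nil_append] at hn
    have hn' : (0 :: pairs (List.ofFn xs)).Nodup := List.Nodup.of_map _ hn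
    have h3 : ∀ i, ∃ j : Fin r, xs i = ((2 * j + 1 : ℕ) : ZMod p) := fun i => by
      obtain ⟨j, hj, h⟩ := exists_odd_of_nodup_pairs hr (by simp) hn' (x := xs i)
        (List.mem_ofFn.2 ⟨i, rfl⟩)
      exact ⟨⟨j, hj⟩, h⟩
    choose σ hσ using h3
    have hxi : Function.Injective xs :=
      List.nodup_ofFn.1 ((List.nodup_cons.1 hn').2.sublist (sublist_pairs _))
    have hσi : Function.Injective σ := fun i j hij => hxi (by rw [hσ, hσ, hij])
    exact ⟨Equiv.ofBijective σ (Finite.injective_iff_bijective.1 hσi), by simp, by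
      funext i; simp [hσ]⟩
  · intro σ _
    have := vand_pairs_perm b (Equiv.Perm.ofFn_comp_perm σ
      (fun i : Fin r => ((2 * i + 1 : ℕ) : ZMod p))) [0]
    simpa [Function.comp_def] using this.symm

end Line

/-! ### A cycle modulo translations with nonzero Vandermonde value -/

section Cycle

/-- The span of the differences between chains and their translates. -/
noncomputable def coinv (R F : Type*) [CommRing R] [Field F] : Submodule R (Chain R F) :=
  Submodule.span _ {x | ∃ g c, shift g c - c = x}

section Coinv

variable {R : Type*} [CommRing R] {F : Type*} [Field F]

lemma shift_sub_mem_coinv (g : F) (c : Chain R F) : shift g c - c ∈ coinv R F :=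
  Submodule.subset_span (show ∃ g' c', shift g' c' - c' = shift g c - c from ⟨g, c, rfl⟩)

lemma map_mem_of_coinv {M : Type*} [AddCommGroup M] [Module R M]
    {f : Chain R F →ₗ[R] M} {N : Submodule R M}
    (h : ∀ g c, f (shift g c) - f c ∈ N) {c : Chain R F} (hc : c ∈ coinv R F) :
    f c ∈ N := by
  have : coinv R F ≤ N.comap f := by
    refine Submodule.span_le.2 ?_
    rintro _ ⟨g, c, rfl⟩
    simpa using h g c
  exact this hc

end Coinv

variable {p : ℕ} [hp : Fact p.Prime] {F : Type*} [Field F] [Algebra (ZMod p) F]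

lemma twist_mem_coinv (b : F) (j : ℕ) (c : Chain (ZMod p) F) : twist b j c ∈ coinv (ZMod p) F := by
  rcases Nat.even_or_odd j with hj | hj
  · have h : twist b j c = ∑ a : ZMod p, (shift (a • b) c - c) := by
      rw [twist_of_even hj, Finset.sum_sub_distrib, Finset.sum_const, Finset.card_univ, ZMod.card,
        ← Nat.cast_smul_eq_nsmul (ZMod p), CharP.cast_eq_zero, zero_smul, sub_zero]
    rw [h]
    exact Submodule.sum_mem _ fun a _ => shift_sub_mem_coinv _ _
  · rw [twist_of_odd hj]
    exact shift_sub_mem_coinv _ _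

lemma shuffleL_mem_coinv (b : F) (j : ℕ) {c : Chain (ZMod p) F} (hc : c ∈ coinv (ZMod p) F) :
    shuffleL b j c ∈ coinv (ZMod p) F := by
  refine map_mem_of_coinv (fun g c => ?_) hc
  rw [shift, ← map_shuffleL (b := b) (fun x a => by ring)]
  exact shift_sub_mem_coinv _ _

lemma bd_shuffleL_mem_coinv (b : F) (j : ℕ) {c : Chain (ZMod p) F}
    (hc : shuffleL b (j + 1) (bd c) ∈ coinv (ZMod p) F) : bd (shuffleL b (j + 1) c) ∈ coinv (ZMod p) F := by
  let f : Chain (ZMod p) F →ₗ[ZMod p] Chain (ZMod p) F :=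
    bd ∘ₗ shuffleL b (j + 1) - shuffleL b (j + 1) ∘ₗ bd
  have h : f c ∈ coinv (ZMod p) F := by
    refine map_mem_of_on (fun l _ => ?_) (mem_on_univ c)
    simp only [f, LinearMap.sub_apply, LinearMap.comp_apply, shuffleL_of, bd_shuffle, sub_sub_cancel_left]
    exact Submodule.neg_mem _ (Submodule.smul_mem _ _ (twist_mem_coinv _ _ _))
  simpa [f] using Submodule.add_mem _ h hc

/-- The iterated shuffle along a list of directions. -/
noncomputable def iter (p : ℕ) [Fact p.Prime] [Algebra (ZMod p) F] : List F → Chain (ZMod p) F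
  | [] => of _ [0]
  | b :: bs => shuffleL b (p ^ bs.length * (p - 1)) (iter p bs)

lemma exists_pow_mul_sub_one_eq (n : ℕ) : ∃ j, p ^ n * (p - 1) = j + 1 :=
  Nat.exists_eq_succ_of_ne_zero
    (Nat.mul_ne_zero (pow_ne_zero _ hp.out.ne_zero) (Nat.sub_ne_zero_of_lt hp.out.one_lt))

lemma bd_iter_mem_coinv (b : F) (bs : List F) : bd (iter p (b :: bs)) ∈ coinv (ZMod p) F := by
  induction bs generalizing b with
  | nil =>
    obtain ⟨j, hj⟩ := exists_pow_mul_sub_one_eq (p := p) 0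
    rw [iter, List.length_nil, hj]
    refine bd_shuffleL_mem_coinv _ _ ?_
    simp [iter, bd_of_cons, shuffle_nil]
  | cons b' bs ih =>
    obtain ⟨j, hj⟩ := exists_pow_mul_sub_one_eq (p := p) (b' :: bs).length
    rw [iter, hj]
    exact bd_shuffleL_mem_coinv _ _ (shuffleL_mem_coinv _ _ (ih b'))

lemma map_iter (f : F →ₗ[ZMod p] F) (bs : List F) : map f (iter p bs) = iter p (bs.map f) := by
  induction bs with
  | nil => simp [iter]
  | cons b bs ih =>
    rw [iter, map_shuffleL (b' := f b) (fun x a => by simp), ih, List.map_cons, iter,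
      List.length_map]

section Len

variable [DecidableEq F]

lemma iter_mem_len (bs : List F) : iter p bs ∈ On (ZMod p) (len F (p ^ bs.length)) := by
  induction bs with
  | nil => exact of_mem_on (by simp [len])
  | cons b bs ih =>
    refine map_mem_of_on (fun l hl => ?_) ih
    have hl : l.length = p ^ bs.length := hl
    have := shuffle_mem_len (p := p) b l (p ^ bs.length * (p - 1))
    rw [hl] at this
    have h : p ^ bs.length + p ^ bs.length * (p - 1) = p ^ (bs.length + 1) := by
      rw [pow_succ, ← mul_one_add, Nat.add_sub_of_le hp.out.one_le]
    rwa [shuffleL_of, List.length_cons, ← h]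

variable [CharP F p]

lemma wvand_shuffle {b : F} (hb : b ≠ 0) (n : ℕ) : ∃ u : F, u ≠ 0 ∧ ∀ l : List F, l.length = n →
    ∀ w : F → F, (∀ y (a : ZMod p), w (y + a • b) = w y) →
    wvand (ZMod p) w (shuffle b l (n * (p - 1))) =
      u * ((l.map w).prod * vand (l.map (art (p := p) b))) ^ p := by
  induction n with
  | zero =>
    refine ⟨1, one_ne_zero, fun l hl w _ => ?_⟩
    rw [List.length_eq_zero_iff.1 hl, Nat.zero_mul, shuffle_zero]
    simp [wvand, vand]
  | succ n ih =>
    obtain ⟨u, hu, ih⟩ := ih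
    refine ⟨((-1) ^ n) ^ (p - 1) * wvand (ZMod p) 1 (shuffle b [0] (p - 1)) * u,
      mul_ne_zero (mul_ne_zero (by simp) (wvand_shuffle_zero_ne_zero hb)) hu, ?_⟩
    intro l hl w hw
    rcases l with _ | ⟨h, l⟩
    · simp at hl
    have hl : l.length = n := by simpa using hl
    have h1 := wvand_app_shuffle hb hw (p - 1) [] h l
      (by simpa using Nat.sub_add_cancel hp.out.one_le) (by simp)
    have h2 : shuffle (p := p) b [h] (p - 1) = shift h (shuffle b [0] (p - 1)) := by
      rw [shift, map_shuffle (b' := b) (fun x a => by ring)]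
      simp
    rw [app_nil, app_nil, hl, h2, wvand_shift _ _ (fun _ => rfl), ih l hl _ (fun y a => by
      rw [hw, art_add_smul])] at h1
    rw [Nat.succ_mul, h1, List.map_cons, List.map_cons, List.prod_cons, vand, List.prod_map_mul,
      List.map_map]
    simp only [Function.comp_def, mul_pow]
    ring

lemma wvand_shuffleL {b : F} (hb : b ≠ 0) (n : ℕ) : ∃ u : F, u ≠ 0 ∧
    ∀ c ∈ On (ZMod p) (len F n), wvand (ZMod p) 1 (shuffleL b (n * (p - 1)) c) =
      u * wvand (ZMod p) 1 (map (art (p := p) b) c) ^ p := by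
  obtain ⟨u, hu, h⟩ := wvand_shuffle (p := p) hb n
  refine ⟨u, hu, fun c hc => ?_⟩
  have := eqOn_of_on (f := wvand (ZMod p) 1 ∘ₗ shuffleL b (n * (p - 1)))
    (g := LinearMap.mulLeft (ZMod p) u ∘ₗ (frobenius F p).toAddMonoidHom.toZModLinearMap p ∘ₗ
      wvand (ZMod p) 1 ∘ₗ map (art (p := p) b)) (fun l hl => ?_) hc
  · simpa [frobenius_def] using this
  · have h1 := h l hl 1 (fun _ _ => rfl)
    have h2 : (l.map (1 : F → F)).prod = 1 := List.prod_eq_one (by simp)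
    rw [h2, one_mul] at h1
    simpa [frobenius_def, wvand_one_of] using h1

lemma exists_wvand_iter_ne_zero [Finite F] (k : ℕ) : ∀ W : Submodule (ZMod p) F,
    k ≤ Module.finrank (ZMod p) W →
    ∃ bs : List F, bs.length = k ∧ (∀ b ∈ bs, b ∈ W) ∧ wvand (ZMod p) 1 (iter p bs) ≠ 0 := by
  have : Module.Finite (ZMod p) F := Module.Finite.of_finite
  induction k with
  | zero => exact fun W _ => ⟨[], rfl, by simp, by simp [iter, wvand_one_of, vand]⟩
  | succ k ih =>
    intro W hW
    have hWb : W ≠ ⊥ := by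
      rintro rfl
      simp at hW
    obtain ⟨b, hbW, hb⟩ := Submodule.exists_mem_ne_zero_of_ne_bot hWb
    have h1 := LinearMap.finrank_range_add_finrank_ker ((art (p := p) b).domRestrict W)
    rw [LinearMap.range_domRestrict] at h1
    have h2 : Module.finrank (ZMod p) (LinearMap.ker ((art (p := p) b).domRestrict W)) ≤ 1 := by
      refine finrank_le_one ⟨⟨b, hbW⟩, by simpa using art_self b⟩ ?_
      rintro ⟨⟨x, hx⟩, h⟩
      have h : art (p := p) b x = 0 := by simpa using h
      rw [← prod_sub_smul hb, Finset.prod_eq_zero_iff] at h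
      obtain ⟨a, -, ha⟩ := h
      exact ⟨a, by ext; simpa using (sub_eq_zero.1 ha).symm⟩
    obtain ⟨bs', hl, hW', hz⟩ := ih (W.map (art (p := p) b)) (by omega)
    obtain ⟨bs, rfl, hbs⟩ : ∃ bs : List F, bs.map (art (p := p) b) = bs' ∧ ∀ x ∈ bs, x ∈ W := by
      clear hz hl
      induction bs' with
      | nil => exact ⟨[], rfl, by simp⟩
      | cons x bs' ih =>
        obtain ⟨bs, rfl, h⟩ := ih fun b hb => hW' b (List.mem_cons_of_mem _ hb)
        obtain ⟨y, hy, rfl⟩ := hW' x List.mem_cons_self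
        exact ⟨y :: bs, rfl, by simpa using ⟨hy, h⟩⟩
    refine ⟨b :: bs, by simpa using hl, by simpa using ⟨hbW, hbs⟩, ?_⟩
    obtain ⟨u, hu, h⟩ := wvand_shuffleL (p := p) hb (p ^ bs.length)
    rw [iter, h _ (iter_mem_len bs), map_iter]
    exact mul_ne_zero hu (pow_ne_zero _ hz)

end Len

/-- In a field of characteristic `p`, there is a chain of words of length the cardinality of the
field, which is a cycle modulo translations, and on which the Vandermonde product does not
vanish. -/
theorem exists_cycle [Finite F] :
    ∃ c ∈ On (ZMod p) (len F (Nat.card F)), bd c ∈ coinv (ZMod p) F ∧ wvand (ZMod p) 1 c ≠ 0 := by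
  classical
  have : CharP F p := charP_of_injective_algebraMap (algebraMap (ZMod p) F).injective p
  have : Module.Finite (ZMod p) F := Module.Finite.of_finite
  have h1 := Module.natCard_eq_pow_finrank (K := ZMod p) (V := F)
  rw [Nat.card_zmod] at h1
  obtain ⟨bs, hl, -, hz⟩ := exists_wvand_iter_ne_zero (p := p) (F := F)
    (Module.finrank (ZMod p) F) ⊤ (by simp)
  refine ⟨iter p bs, ?_, ?_, hz⟩
  · rw [h1, ← hl]
    exact iter_mem_len bs
  · rcases bs with _ | ⟨b, bs⟩
    · exact absurd hl Module.finrank_pos.ne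
    · exact bd_iter_mem_coinv b bs

end Cycle

/-! ### Equivariant chain maps -/

section Equivariant

variable {R : Type*} [CommRing R] {F : Type*} [Field F]

/-- The equivariant linear map determined by its values on the words starting with `0`. -/
noncomputable def equi (f : Chain R F → Chain R F) : Chain R F →ₗ[R] Chain R F := lift fun l =>
  match l with
  | [] => 0
  | g :: t => shift g (f (of R (0 :: t.map (· - g))))

lemma equi_shift (f : Chain R F → Chain R F) (h : F) (c : Chain R F) :
    equi f (shift h c) = shift h (equi f c) := by
  have : equi f ∘ₗ shift h = shift h ∘ₗ equi f := hom_ext fun l => by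
    rcases l with _ | ⟨g, t⟩
    · simp [equi]
    · simp [equi, shift_shift, Function.comp_def]
  exact LinearMap.congr_fun this c

lemma equi_of_zero_cons (f : Chain R F → Chain R F) (t : List F) :
    equi f (of R (0 :: t)) = f (of R (0 :: t)) := by
  simp [equi, shift_zero]

lemma eqOn_of_shift {f g : Chain R F →ₗ[R] Chain R F} {n : ℕ}
    (hf : ∀ h c, f (shift h c) = shift h (f c)) (hg : ∀ h c, g (shift h c) = shift h (g c))
    (h0 : ∀ t : List F, t.length = n → f (of R (0 :: t)) = g (of R (0 :: t)))
    {c : Chain R F} (hc : c ∈ On R (len F (n + 1))) : f c = g c := by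
  refine eqOn_of_on (fun l hl => ?_) hc
  rcases l with _ | ⟨a, t⟩
  · exact absurd (show 0 = n + 1 from hl) (by omega)
  · have h : of R (a :: t) = shift a (of R (0 :: t.map (· - a))) := by
      simp [Function.comp_def]
    rw [h, hf, hg, h0 _ (by simpa [len] using hl)]

lemma equi_mem_len {f : Chain R F → Chain R F} {n : ℕ} {S : Set (List F)}
    (hS : ∀ l ∈ S, ∀ g, l.map (· + g) ∈ S)
    (hf : ∀ t : List F, t.length = n → f (of R (0 :: t)) ∈ On R S) {c : Chain R F}
    (hc : c ∈ On R (len F (n + 1))) : equi f c ∈ On R S := by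
  refine map_mem_of_on (fun l hl => ?_) hc
  rcases l with _ | ⟨a, t⟩
  · exact absurd (show 0 = n + 1 from hl) (by omega)
  · simp only [equi, lift_of]
    exact map_mem_on (fun l hl => hS l hl a) (hf _ (by simpa [len] using hl))

lemma map_add_mem_len {n : ℕ} (l : List F) (hl : l ∈ len F n) (g : F) : l.map (· + g) ∈ len F n := by
  simpa [len] using hl

lemma zero_cons_mem_len {n : ℕ} {t : List F} (ht : t.length = n) :
    of R (0 :: t) ∈ On R (len F (n + 1)) := of_mem_on (by simp [len, ht])

section Homotopy

variable (θ : Chain R F →ₗ[R] Chain R F)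

/-- The cone homotopy between the identity and an equivariant chain map. -/
noncomputable def homotopy : ℕ → Chain R F →ₗ[R] Chain R F
  | 0 => 0
  | n + 1 => equi fun c => cons 0 (θ c - c - homotopy n (bd c))

lemma homotopy_of_zero_cons (n : ℕ) (t : List F) : homotopy θ (n + 1) (of R (0 :: t)) =
    cons 0 (θ (of R (0 :: t)) - of R (0 :: t) - homotopy θ n (bd (of R (0 :: t)))) :=
  equi_of_zero_cons _ t

lemma homotopy_shift (n : ℕ) (h : F) (c : Chain R F) :
    homotopy θ n (shift h c) = shift h (homotopy θ n c) := by
  rcases n with _ | n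
  · simp [homotopy]
  · exact equi_shift _ h c

variable {θ}

lemma homotopy_mem_len {q : ℕ}
    (hlen : ∀ n ≤ q, ∀ c ∈ On R (len F n), θ c ∈ On R (len F n)) (n : ℕ) (hn : n ≤ q) :
    ∀ c ∈ On R (len F n), homotopy θ n c ∈ On R (len F (n + 1)) := by
  induction n with
  | zero => exact fun c _ => Submodule.zero_mem _
  | succ n ih =>
    intro c hc
    refine equi_mem_len map_add_mem_len (fun t ht => ?_) hc
    have h0 := zero_cons_mem_len (R := R) ht
    refine cons_mem_on (S := len F (n + 1)) (fun l hl => by simpa [len] using hl) ?_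
    exact Submodule.sub_mem _ (Submodule.sub_mem _ (hlen _ hn _ h0) h0)
      (ih (by omega) _ (bd_mem_len h0))

lemma bd_homotopy (hshift : ∀ h c, θ (shift h c) = shift h (θ c)) (hnil : θ (of R []) = of R [])
    {q : ℕ} (hbd : ∀ n ≤ q, ∀ c ∈ On R (len F n), bd (θ c) = θ (bd c)) (n : ℕ) (hn : n < q) :
    ∀ c ∈ On R (len F (n + 1)),
      bd (homotopy θ (n + 1) c) = θ c - c - homotopy θ n (bd c) := by
  induction n with
  | zero =>
    intro c hc
    refine eqOn_of_shift (f := bd ∘ₗ homotopy θ 1) (g := θ - LinearMap.id - homotopy θ 0 ∘ₗ bd)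
      (fun h c => ?_) (fun h c => ?_) (fun t ht => ?_) hc
    · simp [homotopy_shift, bd_shift]
    · simp [homotopy_shift, bd_shift, hshift]
    · have h0 := zero_cons_mem_len (R := R) ht
      rw [List.length_eq_zero_iff.1 ht] at h0 ⊢
      have : bd (θ (of R [0])) = bd (of R [0]) := by
        rw [hbd _ (by omega) _ h0]
        simp [bd_of_cons, hnil]
      rw [LinearMap.comp_apply, homotopy_of_zero_cons, bd_cons]
      simp [homotopy, this]
  | succ n ih =>
    intro c hc
    refine eqOn_of_shift (f := bd ∘ₗ homotopy θ (n + 1 + 1))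
      (g := θ - LinearMap.id - homotopy θ (n + 1) ∘ₗ bd)
      (fun h c => ?_) (fun h c => ?_) (fun t ht => ?_) hc
    · simp [homotopy_shift, bd_shift]
    · simp [homotopy_shift, bd_shift, hshift]
    · have h0 := zero_cons_mem_len (R := R) ht
      have h1 := ih (by omega) _ (bd_mem_len h0)
      have h2 := hbd _ hn _ h0
      rw [LinearMap.comp_apply, homotopy_of_zero_cons, bd_cons, map_sub, map_sub, h1,
        map_sub, h2]
      simp [bd_bd]

end Homotopy

section Fill

variable [Fintype F]

/-- The equivariant chain map to injective words. -/
noncomputable def toInj : ℕ → Chain R F →ₗ[R] Chain R F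
  | 0 => LinearMap.id
  | n + 1 => equi fun c =>
    Classical.epsilon fun b => b ∈ On R (inj Finset.univ (n + 1)) ∧ bd b = toInj n (bd c)

lemma map_add_mem_inj {n : ℕ} (l : List F) (hl : l ∈ inj Finset.univ n) (g : F) :
    l.map (· + g) ∈ inj Finset.univ n :=
  ⟨hl.1.map (add_left_injective g), by simpa using hl.2.1, fun _ _ => Finset.mem_univ _⟩

lemma toInj_shift (n : ℕ) (h : F) (c : Chain R F) :
    toInj n (shift h c) = shift h (toInj n c) := by
  rcases n with _ | n
  · simp [toInj]
  · exact equi_shift _ h c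

variable [DecidableEq F]

lemma toInj_spec (n : ℕ) (hn : n ≤ Fintype.card F) : ∀ c ∈ On R (len F n),
    toInj n c ∈ On R (inj Finset.univ n) ∧ bd (toInj n c) = toInj (n - 1) (bd c) := by
  induction n with
  | zero =>
    intro c hc
    refine ⟨on_mono (fun l hl => ?_) hc, by rfl⟩
    rw [List.length_eq_zero_iff.1 hl]
    simp [inj]
  | succ n ih =>
    have key : ∀ t : List F, t.length = n → ∃ b : Chain R F,
        b ∈ On R (inj Finset.univ (n + 1)) ∧ bd b = toInj n (bd (of R (0 :: t))) := by
      intro t ht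
      obtain ⟨h1, h2⟩ := ih (by omega) _ (bd_mem_len (zero_cons_mem_len (R := R) ht))
      exact fillable Finset.univ n (by rw [Finset.card_univ]; omega) _ h1
        (by rw [h2, bd_bd, map_zero])
    have key' : ∀ t : List F, t.length = n →
        toInj (n + 1) (of R (0 :: t)) ∈ On R (inj Finset.univ (n + 1)) ∧
          bd (toInj (n + 1) (of R (0 :: t))) = toInj n (bd (of R (0 :: t))) := by
      intro t ht
      have h := Classical.epsilon_spec (key t ht)
      rw [toInj, equi_of_zero_cons]
      exact h
    intro c hc
    refine ⟨equi_mem_len map_add_mem_inj (fun t ht => ?_) hc, ?_⟩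
    · have h := (key' t ht).1
      rwa [toInj, equi_of_zero_cons] at h
    · let f : Chain R F →ₗ[R] Chain R F := bd ∘ₗ toInj (n + 1)
      let g : Chain R F →ₗ[R] Chain R F := toInj n ∘ₗ bd
      have hf : ∀ h c, f (shift h c) = shift h (f c) := fun h c => by
        rw [LinearMap.comp_apply, toInj_shift, bd_shift, LinearMap.comp_apply]
      have hg : ∀ h c, g (shift h c) = shift h (g c) := fun h c => by
        rw [LinearMap.comp_apply, bd_shift, toInj_shift, LinearMap.comp_apply]
      exact eqOn_of_shift hf hg (fun t ht => (key' t ht).2) hc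

end Fill

end Equivariant

section Degree

variable {p : ℕ} [hp : Fact p.Prime] {F : Type*} [Field F] [Algebra (ZMod p) F] [Fintype F]

/-- An equivariant chain map does not annihilate the Vandermonde product. -/
theorem exists_wvand_ne_zero {θ : Chain (ZMod p) F →ₗ[ZMod p] Chain (ZMod p) F}
    (hshift : ∀ h c, θ (shift h c) = shift h (θ c)) (hnil : θ (of _ []) = of _ [])
    (hlen : ∀ n ≤ Fintype.card F, ∀ c ∈ On (ZMod p) (len F n), θ c ∈ On (ZMod p) (len F n))
    (hbd : ∀ n ≤ Fintype.card F, ∀ c ∈ On (ZMod p) (len F n), bd (θ c) = θ (bd c)) :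
    ∃ l : List F, l.length = Fintype.card F ∧ wvand (ZMod p) 1 (θ (of _ l)) ≠ 0 := by
  obtain ⟨c, hc, hb, hv⟩ := exists_cycle (p := p) (F := F)
  rw [Nat.card_eq_fintype_card] at hc
  obtain ⟨n, hn⟩ : ∃ n, Fintype.card F = n + 1 :=
    Nat.exists_eq_succ_of_ne_zero Fintype.card_ne_zero
  rw [hn] at hc
  have h1 := bd_homotopy hshift hnil hbd n (by omega) c hc
  have h2 : wvand (ZMod p) 1 (bd (homotopy θ (n + 1) c)) = 0 :=
    wvand_one_bd (homotopy_mem_len hlen _ hn.ge c hc)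
  have h3 : wvand (ZMod p) 1 (homotopy θ n (bd c)) = 0 := by
    have := map_mem_of_coinv (f := wvand (ZMod p) 1 ∘ₗ homotopy θ n) (N := ⊥) (fun g c => by
      simp [homotopy_shift, wvand_shift 1 g (fun _ => rfl)]) hb
    simpa using this
  rw [h1, map_sub, map_sub, h3, sub_zero, sub_eq_zero] at h2
  by_contra! h
  refine hv (h2 ▸ ?_)
  have := map_mem_of_on (f := wvand (ZMod p) 1 ∘ₗ θ) (N := ⊥) (fun l hl => ?_) hc
  · simpa using this
  · have hl : l.length = n + 1 := hl
    simpa using h l (by omega)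

end Degree

/-! ### Barycentric subdivision -/

section Subdivision

lemma norm_sum_sub_le {E : Type*} [NormedAddCommGroup E] {r : ℝ} (x : E) (l : List E) (h : ∀ y ∈ l, dist y x ≤ r) :
    ‖l.sum - l.length • x‖ ≤ l.length * r := by
  induction l with
  | nil => simp
  | cons y l ih =>
    have h1 := ih fun y hy => h y (List.mem_cons_of_mem _ hy)
    have h2 := h y List.mem_cons_self
    rw [dist_eq_norm] at h2
    calc ‖(y :: l).sum - (y :: l).length • x‖ = ‖(y - x) + (l.sum - l.length • x)‖ := by
          congr 1
          rw [List.sum_cons, List.length_cons, add_smul, one_smul]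
          abel
      _ ≤ r + l.length * r := (norm_add_le _ _).trans (add_le_add h2 h1)
      _ = (y :: l).length * r := by push_cast [List.length_cons]; ring

variable {R : Type*} [CommRing R] {E : Type*} [NormedAddCommGroup E] [NormedSpace ℝ E]

/-- The barycenter of a word. -/
noncomputable def bary (l : List E) : E := (l.length : ℝ)⁻¹ • l.sum

/-- Barycentric subdivision of chains of words of length `n`. -/
noncomputable def sdLen : ℕ → Chain R E →ₗ[R] Chain R E
  | 0 => LinearMap.id
  | n + 1 => lift fun l => cons (bary l) (sdLen n (bd (of R l)))

/-- Barycentric subdivision. -/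
noncomputable def sd : Chain R E →ₗ[R] Chain R E := lift fun l => sdLen l.length (of R l)

lemma sd_eq {n : ℕ} {c : Chain R E} (hc : c ∈ On R (len E n)) : sd c = sdLen n c :=
  eqOn_of_on (fun l hl => by
    have hl : l.length = n := hl
    simp [sd, hl]) hc

lemma sd_of_nil : sd (of R ([] : List E)) = of R [] := by simp [sd, sdLen]

lemma sd_of {l : List E} (hl : l ≠ []) : sd (of R l) = cons (bary l) (sd (bd (of R l))) := by
  rw [sd_eq (bd_mem_len_pred l)]
  obtain ⟨n, hn⟩ : ∃ n, l.length = n + 1 :=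
    Nat.exists_eq_succ_of_ne_zero (by simpa using hl)
  simp [sd, hn, sdLen]

lemma sd_bd (c : Chain R E) : bd (sd c) = sd (bd c) := by
  have h : ∀ n, ∀ l : List E, l.length = n → bd (sd (of R l)) = sd (bd (of R l)) := by
    intro n
    induction n with
    | zero => intro l hl; rw [List.length_eq_zero_iff.1 hl]; simp [sd_of_nil]
    | succ n ih =>
      intro l hl
      have h1 : bd (sd (bd (of R l))) = 0 := by
        have h2 := bd_mem_len_pred (R := R) l
        rw [hl] at h2
        have := eqOn_of_on (f := bd ∘ₗ sd) (g := sd ∘ₗ bd) (fun l hl => by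
          simpa using ih l hl) h2
        simpa [bd_bd] using this
      rw [sd_of (by rintro rfl; simp at hl), bd_cons, h1]
      simp
  have := hom_ext (f := bd ∘ₗ sd (R := R) (E := E)) (g := sd ∘ₗ bd) fun l => by
    simpa using h _ l rfl
  simpa using LinearMap.congr_fun this c

lemma map_sd {E' : Type*} [NormedAddCommGroup E'] [NormedSpace ℝ E'] (T : E →ₗ[ℝ] E')
    (c : Chain R E) : map T (sd c) = sd (map T c) := by
  have h : ∀ n, ∀ l : List E, l.length = n → map T (sd (of R l)) = sd (of R (l.map T)) := by
    intro n
    induction n with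
    | zero => intro l hl; rw [List.length_eq_zero_iff.1 hl]; simp [sd_of_nil]
    | succ n ih =>
      intro l hl
      have hl0 : l ≠ [] := by rintro rfl; simp at hl
      have h1 : map T (sd (bd (of R l))) = sd (map T (bd (of R l))) := by
        have h2 := bd_mem_len_pred (R := R) l
        rw [hl] at h2
        exact eqOn_of_on (f := map T ∘ₗ sd) (g := sd ∘ₗ map T) (fun l hl => by
          simpa using ih l hl) h2
      rw [sd_of hl0, sd_of (by simpa using hl0), map_cons, h1, ← bd_map, map_of]
      simp [bary, map_list_sum]
  have := hom_ext (f := map T ∘ₗ sd (R := R) (E := E)) (g := sd ∘ₗ map T) fun l => by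
    simpa using h _ l rfl
  simpa using LinearMap.congr_fun this c

lemma bary_mem {K : Set E} (hK : Convex ℝ K) {l : List E} (hl : l ≠ []) (h : ∀ x ∈ l, x ∈ K) :
    bary l ∈ K := by
  have hpos : (l.length : ℝ) ≠ 0 := by simpa using hl
  have := hK.sum_mem (t := Finset.univ) (w := fun _ : Fin l.length => (l.length : ℝ)⁻¹)
    (z := l.get) (fun _ _ => by positivity) (by simp [hpos]) (fun i _ => h _ (l.get_mem i))
  rw [← Finset.smul_sum, ← List.sum_ofFn, List.ofFn_get] at this
  exact this

lemma sd_of_mem_on {K : Set E} (hK : Convex ℝ K) : ∀ n, ∀ l : List E, l.length = n →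
    (∀ x ∈ l, x ∈ K) → sd (of R l) ∈ On R {u | u.length = n ∧ ∀ x ∈ u, x ∈ K} := by
  intro n
  induction n with
  | zero =>
    intro l hl _
    rw [List.length_eq_zero_iff.1 hl, sd_of_nil]
    exact of_mem_on ⟨rfl, by simp⟩
  | succ n ih =>
    intro l hl h
    have hl0 : l ≠ [] := by rintro rfl; simp at hl
    rw [sd_of hl0]
    refine cons_mem_on (S := {u | u.length = n ∧ ∀ x ∈ u, x ∈ K}) (fun u hu => ?_)
      (map_mem_of_on (fun u hu => ih u ?_ fun x hx => ?_) (bd_of_mem_on l))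
    · exact ⟨by simp [hu.1], by simpa using ⟨bary_mem hK hl0 h, hu.2⟩⟩
    · have := hu.2; omega
    · exact h x (hu.1.subset hx)

lemma dist_bary_le {l : List E} {r : ℝ} (h : ∀ x ∈ l, ∀ y ∈ l, dist x y ≤ r) {x : E} (hx : x ∈ l) :
    dist x (bary l) ≤ (1 - (l.length : ℝ)⁻¹) * r := by
  classical
  have hp := List.perm_cons_erase hx
  have hl : l.length = (l.erase x).length + 1 := by simpa using hp.length_eq
  have hs : l.sum = x + (l.erase x).sum := by simpa using hp.sum_eq
  have hpos : (0 : ℝ) < l.length := by rw [hl]; positivity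
  have h1 := norm_sum_sub_le x (l.erase x) fun y hy => h y (List.mem_of_mem_erase hy) x hx
  have h2 : bary l - x = (l.length : ℝ)⁻¹ • ((l.erase x).sum - (l.erase x).length • x) := by
    have : x = (l.length : ℝ)⁻¹ • ((l.length : ℝ) • x) := by
      rw [smul_smul, inv_mul_cancel₀ hpos.ne', one_smul]
    conv_lhs => rw [this]
    rw [bary, hs, ← smul_sub, hl]
    congr 1
    push_cast
    rw [add_smul, one_smul, Nat.cast_smul_eq_nsmul]
    abel
  rw [dist_comm, dist_eq_norm, h2, norm_smul, norm_inv, Real.norm_natCast]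
  calc (l.length : ℝ)⁻¹ * ‖(l.erase x).sum - (l.erase x).length • x‖
      ≤ (l.length : ℝ)⁻¹ * ((l.erase x).length * r) := by gcongr
    _ = (1 - (l.length : ℝ)⁻¹) * r := by
      have : ((l.erase x).length : ℝ) = l.length - 1 := by rw [hl]; simp
      rw [this]
      field_simp

/-- Words of length `n` with letters in `K` and pairwise distances at most `r`. -/
def fine (K : Set E) (n : ℕ) (r : ℝ) : Set (List E) :=
  {u | u.length = n ∧ (∀ x ∈ u, x ∈ K) ∧ ∀ x ∈ u, ∀ y ∈ u, dist x y ≤ r}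

lemma sd_of_mem_fine {K : Set E} (hK : Convex ℝ K) {q : ℕ} {r : ℝ} (hr : 0 ≤ r) : ∀ n ≤ q,
    ∀ l ∈ fine K n r, sd (of R l) ∈ On R (fine K n ((1 - (q : ℝ)⁻¹) * r)) := by
  intro n
  induction n with
  | zero =>
    intro _ l hl
    rw [List.length_eq_zero_iff.1 hl.1, sd_of_nil]
    exact of_mem_on ⟨rfl, by simp, by simp⟩
  | succ n ih =>
    rintro hn l ⟨hl, hlK, h⟩
    have hl0 : l ≠ [] := by rintro rfl; simp at hl
    have hq : (l.length : ℝ) ≤ q := by rw [hl]; exact_mod_cast hn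
    have hpos : (0 : ℝ) < l.length := by rw [hl]; positivity
    have hk : (1 - (l.length : ℝ)⁻¹) * r ≤ (1 - (q : ℝ)⁻¹) * r := by
      gcongr
    have hk0 : 0 ≤ (1 - (q : ℝ)⁻¹) * r := by
      refine mul_nonneg (sub_nonneg.2 (inv_le_one_of_one_le₀ ?_)) hr
      have : 1 ≤ q := by omega
      exact_mod_cast this
    rw [sd_of hl0]
    have hball := (convex_closedBall (bary l) ((1 - (q : ℝ)⁻¹) * r)).inter hK
    have h1 : ∀ x ∈ l, x ∈ Metric.closedBall (bary l) ((1 - (q : ℝ)⁻¹) * r) ∩ K := fun x hx =>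
      ⟨(dist_bary_le h hx).trans hk, hlK x hx⟩
    have h2 : sd (bd (of R l)) ∈ On R {u | u ∈ fine K n ((1 - (q : ℝ)⁻¹) * r) ∧
        ∀ x ∈ u, x ∈ Metric.closedBall (bary l) ((1 - (q : ℝ)⁻¹) * r) ∩ K} := by
      refine map_mem_of_on (fun u hu => ?_) (bd_of_mem_on l)
      have hun : u.length = n := by have := hu.2; omega
      have h3 := ih (by omega) u ⟨hun, fun x hx => hlK x (hu.1.subset hx),
        fun x hx y hy => h x (hu.1.subset hx) y (hu.1.subset hy)⟩
      have h4 := sd_of_mem_on (R := R) hball n u hun fun x hx => h1 x (hu.1.subset hx)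
      rw [Chain.On, Finsupp.mem_supported] at h3 h4 ⊢
      exact fun v hv => ⟨h3 hv, (h4 hv).2⟩
    refine cons_mem_on (fun u hu => ?_) h2
    obtain ⟨⟨hu1, hu2, hu3⟩, hu4⟩ := hu
    refine ⟨by simp [hu1], by simpa using ⟨bary_mem hK hl0 hlK, hu2⟩, ?_⟩
    simp only [List.mem_cons, forall_eq_or_imp, dist_self]
    refine ⟨⟨hk0, fun y hy => ?_⟩, fun x hx => ⟨(hu4 x hx).1, hu3 x hx⟩⟩
    rw [dist_comm]
    exact (hu4 y hy).1

lemma sd_iterate_mem_fine {K : Set E} (hK : Convex ℝ K) {q n : ℕ} (hn : n ≤ q) {r : ℝ}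
    (hr : 0 ≤ r) {l : List E} (hl : l ∈ fine K n r) (N : ℕ) :
    sd^[N] (of R l) ∈ On R (fine K n ((1 - (q : ℝ)⁻¹) ^ N * r)) := by
  induction N with
  | zero => simpa using of_mem_on hl
  | succ N ih =>
    rw [Function.iterate_succ_apply', pow_succ', mul_assoc]
    refine map_mem_of_on (fun u hu => sd_of_mem_fine hK ?_ n hn u hu) ih
    refine mul_nonneg (pow_nonneg (sub_nonneg.2 ?_) _) hr
    exact Nat.cast_inv_le_one q

lemma bd_sd_iterate (N : ℕ) (c : Chain R E) : bd (sd^[N] c) = sd^[N] (bd c) := by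
  induction N with
  | zero => rfl
  | succ N ih => rw [Function.iterate_succ_apply', Function.iterate_succ_apply', sd_bd, ih]

lemma map_sd_iterate {E' : Type*} [NormedAddCommGroup E'] [NormedSpace ℝ E'] (T : E →ₗ[ℝ] E')
    (N : ℕ) (c : Chain R E) : map T (sd^[N] c) = sd^[N] (map T c) := by
  induction N with
  | zero => rfl
  | succ N ih => rw [Function.iterate_succ_apply', Function.iterate_succ_apply', map_sd, ih]

end Subdivision

/-! ### A labelling theorem -/

section Labelling

lemma map_congr_on {R α β : Type*} [CommRing R] {f g : α → β} {S : Set (List α)}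
    (h : ∀ l ∈ S, ∀ x ∈ l, f x = g x) {c : Chain R α} (hc : c ∈ On R S) : map f c = map g c :=
  eqOn_of_on (fun l hl => by rw [map_of, map_of, List.map_congr_left (h l hl)]) hc

lemma filter_eq_of_sublist {α : Type*} [DecidableEq α] {u u' : List α} (hu : u.Nodup)
    (h : u'.Sublist u) (P : α → Bool) (hP : ∀ a, P a = true → a ∈ u') :
    u.filter P = u'.filter P := by
  refine ((h.filter P).eq_of_length (List.Perm.length_eq ?_)).symm
  refine (List.perm_ext_iff_of_nodup ((h.nodup hu).filter P) (hu.filter P)).2 fun a => ?_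
  rw [List.mem_filter, List.mem_filter]
  exact ⟨fun ha => ⟨h.subset ha.1, ha.2⟩, fun ha => ⟨hP a ha.2, ha.2⟩⟩

variable {F : Type*}

/-- The label of the point `x` in the cell of the word `u`. -/
noncomputable def lab (μ : List F → (F → ℝ) → F) (u : List F) (x : F → ℝ) : F :=
  μ (u.filter fun g => x g ≠ 0) x

variable [Fintype F]

/-- The points of the standard simplex supported by the letters of `u`. -/
def face (u : List F) : Set (F → ℝ) := {x | x ∈ stdSimplex ℝ F ∧ ∀ g, x g ≠ 0 → g ∈ u}

lemma convex_face (u : List F) : Convex ℝ (face u) := by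
  intro x hx y hy a b ha hb hab
  refine ⟨convex_stdSimplex ℝ F hx.1 hy.1 ha hb hab, fun g hg => ?_⟩
  by_contra h
  have h1 : x g = 0 := not_not.1 (mt (hx.2 g) h)
  have h2 : y g = 0 := not_not.1 (mt (hy.2 g) h)
  simp [h1, h2] at hg

lemma filter_ne_nil_of_mem_face {u : List F} {x : F → ℝ} (hx : x ∈ face u) :
    (u.filter fun g => x g ≠ 0) ≠ [] := by
  obtain ⟨g, -, hg⟩ : ∃ g ∈ Finset.univ, x g ≠ 0 :=
    Finset.exists_ne_zero_of_sum_ne_zero (by rw [hx.1.2]; exact one_ne_zero)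
  exact List.ne_nil_of_mem (List.mem_filter.2 ⟨hx.2 g hg, by simpa using hg⟩)

variable [DecidableEq F]

/-- The vertices of the standard simplex. -/
noncomputable def vertex (g : F) : F → ℝ := Pi.single g 1

lemma map_vertex_mem_fine (u : List F) : u.map vertex ∈ fine (face u) u.length 1 := by
  refine ⟨by simp, ?_, ?_⟩
  · simp only [List.mem_map, forall_exists_index, and_imp, forall_apply_eq_imp_iff₂]
    refine fun g hg => ⟨single_mem_stdSimplex ℝ g, fun h hh => ?_⟩
    by_cases hgh : h = g
    · rwa [hgh]
    · simp [vertex, hgh] at hh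
  · simp only [List.mem_map, forall_exists_index, and_imp, forall_apply_eq_imp_iff₂]
    refine fun g _ h _ => (dist_pi_le_iff zero_le_one).2 fun y => ?_
    rw [vertex, vertex, Pi.single_apply, Pi.single_apply]
    split_ifs <;> simp

variable {R : Type*} [CommRing R]

lemma sd_vertex_mem_fine (N : ℕ) {q : ℕ} (u : List F) (hu : u.length ≤ q) :
    sd^[N] (of R (u.map vertex)) ∈ On R (fine (face u) u.length ((1 - (q : ℝ)⁻¹) ^ N)) := by
  have := sd_iterate_mem_fine (R := R) (convex_face u) hu zero_le_one (map_vertex_mem_fine u) N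
  rwa [mul_one] at this

/-- Subdivide the cell of each word and replace the points by their labels. -/
noncomputable def label (R : Type*) [CommRing R] (μ : List F → (F → ℝ) → F) (N : ℕ) :
    Chain R F →ₗ[R] Chain R F :=
  lift fun u => map (lab μ u) (sd^[N] (of R (u.map vertex)))

lemma label_of (μ : List F → (F → ℝ) → F) (N : ℕ) (u : List F) :
    label R μ N (of R u) = map (lab μ u) (sd^[N] (of R (u.map vertex))) := by
  simp [label]

lemma label_mem_len (μ : List F → (F → ℝ) → F) (N n : ℕ) {c : Chain R F}
    (hc : c ∈ On R (len F n)) : label R μ N c ∈ On R (len F n) := by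
  refine map_mem_of_on (fun u hu => ?_) hc
  have hu : u.length = n := hu
  rw [label_of]
  exact map_mem_on (fun l hl => by simpa [len, hu] using hl.1) (sd_vertex_mem_fine N u le_rfl)

lemma label_of_nil (μ : List F → (F → ℝ) → F) (N : ℕ) : label R μ N (of R []) = of R [] := by
  have h : sd^[N] (of R ([] : List (F → ℝ))) = of R [] := by
    induction N with
    | zero => rfl
    | succ N ih => rw [Function.iterate_succ_apply', ih, sd_of_nil]
  rw [label_of, List.map_nil, h, map_of, List.map_nil]

lemma bd_label (μ : List F → (F → ℝ) → F) (N : ℕ) {c : Chain R F}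
    (hc : c ∈ On R {u | u.Nodup}) : bd (label R μ N c) = label R μ N (bd c) := by
  refine eqOn_of_on (f := bd ∘ₗ label R μ N) (g := label R μ N ∘ₗ bd) (fun u hu => ?_) hc
  have hu : u.Nodup := hu
  rw [LinearMap.comp_apply, LinearMap.comp_apply, label_of, bd_map, bd_sd_iterate, ← map_of,
    bd_map]
  have := eqOn_of_on (f := map (lab μ u) ∘ₗ (sd ^ N : Module.End R _) ∘ₗ map vertex)
    (g := label R μ N) (fun u' hu' => ?_) (bd_of_mem_on (R := R) u)
  · simpa [Module.End.pow_apply] using this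
  · rw [label_of, LinearMap.comp_apply, LinearMap.comp_apply, Module.End.pow_apply, map_of]
    refine map_congr_on (fun l hl x hx => ?_) (sd_vertex_mem_fine N u' le_rfl)
    rw [lab, lab, filter_eq_of_sublist hu hu'.1 _ fun a ha => (hl.2.1 x hx).2 a (by simpa using ha)]

end Labelling

section LabellingField

variable {F : Type*} [Field F] [Fintype F] [DecidableEq F]

/-- Translations of the index set act on the simplex. -/
lemma label_shift {R : Type*} [CommRing R] {μ : List F → (F → ℝ) → F}
    (hμ : ∀ v x h, v ≠ [] → μ (v.map (· + h)) (fun y => x (y - h)) = μ v x + h)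
    (N : ℕ) (h : F) (c : Chain R F) : label R μ N (shift h c) = shift h (label R μ N c) := by
  have := hom_ext (f := label R μ N ∘ₗ shift h) (g := shift h ∘ₗ label R μ N) fun u => ?_
  · exact LinearMap.congr_fun this c
  have h1 : (u.map (· + h)).map vertex =
      (u.map vertex).map (LinearMap.funLeft ℝ ℝ (fun y : F => y - h)) := by
    rw [List.map_map, List.map_map]
    refine List.map_congr_left fun g _ => ?_
    funext y
    simp [vertex, Pi.single_apply, LinearMap.funLeft_apply, sub_eq_iff_eq_add]
  rw [LinearMap.comp_apply, LinearMap.comp_apply, shift_of, label_of, label_of, h1, ← map_of,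
    ← map_sd_iterate, shift, map_map, map_map]
  refine map_congr_on (fun l hl x hx => ?_) (sd_vertex_mem_fine N u le_rfl)
  rw [Function.comp_apply, Function.comp_apply, lab, lab,
    ← hμ _ _ _ (filter_ne_nil_of_mem_face (hl.2.1 x hx)), List.filter_map]
  simp [Function.comp_def, LinearMap.funLeft_apply]
  rfl

/-- An equivariant labelling of the cells of the complex of injective words takes all values in
a small neighbourhood of some point of a cell of maximal dimension. -/
theorem exists_small_of_labelling {p : ℕ} [Fact p.Prime] [Algebra (ZMod p) F]
    {μ : List F → (F → ℝ) → F}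
    (hμ : ∀ v x h, v ≠ [] → μ (v.map (· + h)) (fun y => x (y - h)) = μ v x + h)
    {ε : ℝ} (hε : 0 < ε) :
    ∃ u : List F, u.Nodup ∧ (∀ g, g ∈ u) ∧ ∃ P : F → F → ℝ, (∀ g, P g ∈ stdSimplex ℝ F) ∧
      (∀ g h, dist (P g) (P h) < ε) ∧ ∀ g, μ (u.filter fun h => P g h ≠ 0) (P g) = g := by
  set q := Fintype.card F with hq
  have hq1 : 1 ≤ q := Fintype.card_pos
  obtain ⟨N, hN⟩ : ∃ N, (1 - (q : ℝ)⁻¹) ^ N < ε := by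
    refine exists_pow_lt_of_lt_one hε ?_
    have : (0 : ℝ) < (q : ℝ)⁻¹ := by positivity
    linarith
  let ψ : Chain (ZMod p) F →ₗ[ZMod p] Chain (ZMod p) F := lift fun l => toInj l.length (of _ l)
  have hψ : ∀ n, ∀ c ∈ On (ZMod p) (len F n), ψ c = toInj n c := fun n c hc =>
    eqOn_of_on (fun l hl => by
      have hl : l.length = n := hl
      simp [ψ, hl]) hc
  have hψs : ∀ h c, ψ (shift h c) = shift h (ψ c) := fun h c => by
    refine LinearMap.congr_fun (hom_ext (f := ψ ∘ₗ shift h) (g := shift h ∘ₗ ψ) fun l => ?_) c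
    simp only [ψ, LinearMap.comp_apply, shift_of, lift_of, List.length_map, ← toInj_shift]
  have hψm : ∀ n ≤ q, ∀ c ∈ On (ZMod p) (len F n), ψ c ∈ On (ZMod p) (inj Finset.univ n) :=
    fun n hn c hc => by rw [hψ n c hc]; exact (toInj_spec n hn c hc).1
  obtain ⟨l, hl, hv⟩ : ∃ l : List F, l.length = q ∧
      wvand (ZMod p) 1 (label _ μ N (ψ (of _ l))) ≠ 0 := by
    refine exists_wvand_ne_zero (p := p) (θ := label _ μ N ∘ₗ ψ) (fun h c => ?_) ?_
      (fun n hn c hc => ?_) (fun n hn c hc => ?_)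
    · simp only [LinearMap.comp_apply, hψs, label_shift hμ]
    · simp [ψ, toInj, label_of_nil]
    · exact label_mem_len μ N n (on_mono (fun u hu => hu.2.1) (hψm n hn c hc))
    · rw [LinearMap.comp_apply, LinearMap.comp_apply,
        bd_label μ N (on_mono (fun u hu => hu.1) (hψm n hn c hc)), hψ n c hc,
        (toInj_spec n hn c hc).2]
      rcases n with _ | n
      · have : bd c = 0 :=
          eqOn_of_on (g := 0) (fun l hl => by simp [List.length_eq_zero_iff.1 hl]) hc
        simp [this]
      · rw [hψ n _ (bd_mem_len hc), Nat.add_sub_cancel]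
  have hl : of (ZMod p) l ∈ On (ZMod p) (len F q) := of_mem_on hl
  obtain ⟨u, hu, huv⟩ : ∃ u ∈ inj (Finset.univ : Finset F) q,
      wvand (ZMod p) 1 (label _ μ N (of _ u)) ≠ 0 := by
    by_contra! h
    refine hv ?_
    simpa using map_mem_of_on (f := wvand (ZMod p) 1 ∘ₗ label _ μ N) (N := ⊥)
      (fun u hu => by simpa using h u hu) (hψm q le_rfl _ hl)
  rw [label_of] at huv
  obtain ⟨w, hw, hwv⟩ : ∃ w ∈ fine (face u) u.length ((1 - (q : ℝ)⁻¹) ^ N),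
      wvand (ZMod p) 1 (of _ (w.map (lab μ u))) ≠ 0 := by
    by_contra! h
    refine huv ?_
    simpa using map_mem_of_on (f := wvand (ZMod p) 1 ∘ₗ map (lab μ u)) (N := ⊥)
      (fun w hw => by simpa using h w hw) (sd_vertex_mem_fine (R := ZMod p) N u hu.2.1.le)
  rw [wvand_one_of, vand_nodup] at hwv
  have hall : ∀ {v : List F}, v.Nodup → v.length = q → ∀ g, g ∈ v := by
    intro v hv hvq g
    have h1 : v.toFinset = Finset.univ := by
      rw [← Finset.card_eq_iff_eq_univ, List.toFinset_card_of_nodup hv, hvq]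
    exact List.mem_toFinset.1 (h1 ▸ Finset.mem_univ g)
  have hg : ∀ g, ∃ x ∈ w, lab μ u x = g := fun g =>
    List.mem_map.1 (hall hwv (by simp [hw.1, hu.2.1]) g)
  choose P hP hPg using hg
  exact ⟨u, hu.1, hall hu.1 hu.2.1, P, fun g => (hw.2.1 _ (hP g)).1,
    fun g h => (hw.2.2 _ (hP g) _ (hP h)).trans_lt hN, hPg⟩

end LabellingField

section Correspondence

variable {F : Type*} [Field F] [Fintype F] [DecidableEq F]

/-- The set-valued version of `exists_small_of_labelling`. -/
theorem exists_small_of_mem {p : ℕ} [Fact p.Prime] [Algebra (ZMod p) F]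
    {M : List F → (F → ℝ) → Set F}
    (hM : ∀ v x h g, g ∈ M (v.map (· + h)) (fun y => x (y - h)) ↔ g - h ∈ M v x)
    (hne : ∀ v x, v.Nodup → x ∈ stdSimplex ℝ F → (∀ g, x g ≠ 0 ↔ g ∈ v) → (M v x).Nonempty)
    {ε : ℝ} (hε : 0 < ε) :
    ∃ u : List F, u.Nodup ∧ (∀ g, g ∈ u) ∧ ∃ P : F → F → ℝ, (∀ g, P g ∈ stdSimplex ℝ F) ∧
      (∀ g h, dist (P g) (P h) < ε) ∧ ∀ g, g ∈ M (u.filter fun h => P g h ≠ 0) (P g) := by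
  classical
  let ch : Set F → F := fun S => if h : S.Nonempty then h.some else 0
  let μ : List F → (F → ℝ) → F := fun v x =>
    v.headD 0 + ch (M (v.map (· + -v.headD 0)) fun y => x (y - -v.headD 0))
  have hμ : ∀ v x h, v ≠ [] → μ (v.map (· + h)) (fun y => x (y - h)) = μ v x + h := by
    rintro v x h hv
    obtain ⟨a, t, rfl⟩ := List.exists_cons_of_ne_nil hv
    simp only [μ, List.map_cons, List.headD_cons, List.map_map]
    rw [add_right_comm]
    congr! 4
    · simp
    · funext y
      congr 1
      ring
  have hmem : ∀ v x, (M v x).Nonempty → μ v x ∈ M v x := by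
    intro v x hvx
    have h : (M (v.map (· + -v.headD 0)) fun y => x (y - -v.headD 0)).Nonempty := by
      obtain ⟨g, hg⟩ := hvx
      exact ⟨g + -v.headD 0, (hM v x _ _).2 (by simpa using hg)⟩
    have h1 : ch (M (v.map (· + -v.headD 0)) fun y => x (y - -v.headD 0)) ∈
        M (v.map (· + -v.headD 0)) fun y => x (y - -v.headD 0) := by
      simp only [ch, dif_pos h]
      exact h.some_mem
    have h2 := (hM v x _ _).1 h1
    rwa [sub_neg_eq_add, add_comm] at h2
  obtain ⟨u, hu, hall, P, hP, hd, hl⟩ := exists_small_of_labelling (p := p) hμ hε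
  refine ⟨u, hu, hall, P, hP, hd, fun g => ?_⟩
  have := hmem (u.filter fun h => P g h ≠ 0) (P g)
    (hne _ _ (hu.filter _) (hP g) fun h => by simp [hall])
  rwa [hl g] at this

end Correspondence

end Chain

namespace LayeredCake

section Assignment

variable {I J : Type*} [Fintype I] [Fintype J]

/-- The number of rows is bounded by the total weight of the columns they meet. -/
theorem card_mul_card_le {f : I → J → ℝ} (hf : ∀ i j, 0 ≤ f i j) (hrow : ∀ i, ∑ j, f i j = 1)
    (hcol : ∀ j, ∑ i, f i j = Fintype.card I / Fintype.card J) (S : Finset I) :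
    S.card * Fintype.card J ≤
      ({j | ∃ i ∈ S, 0 < f i j} : Finset J).card * Fintype.card I := by
  classical
  rcases isEmpty_or_nonempty J with h | h
  · simp
  set T : Finset J := {j | ∃ i ∈ S, 0 < f i j}
  have h1 : (S.card : ℝ) ≤ T.card * (Fintype.card I / Fintype.card J) := by
    calc (S.card : ℝ) = ∑ i ∈ S, ∑ j, f i j := by simp [hrow]
      _ = ∑ i ∈ S, ∑ j ∈ T, f i j := by
        refine Finset.sum_congr rfl fun i hi => (Finset.sum_subset T.subset_univ ?_).symm
        intro j _ hj
        by_contra hne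
        exact hj (by simpa [T] using ⟨i, hi, (hf i j).lt_of_ne' hne⟩)
      _ ≤ ∑ i, ∑ j ∈ T, f i j := Finset.sum_le_sum_of_subset_of_nonneg S.subset_univ
        fun i _ _ => Finset.sum_nonneg fun j _ => hf i j
      _ = T.card * (Fintype.card I / Fintype.card J) := by
        rw [Finset.sum_comm]
        simp [hcol]
  have hJ : (0 : ℝ) < Fintype.card J := by exact_mod_cast Fintype.card_pos
  rw [← mul_div_assoc, le_div_iff₀ hJ] at h1
  exact_mod_cast h1

/-- A fractional assignment with equal column sums can be rounded to an assignment with prescribed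
loads, the column `jstar` having the smallest load. -/
theorem exists_balanced_assignment [DecidableEq J] {f : I → J → ℝ} (hf : ∀ i j, 0 ≤ f i j)
    (hrow : ∀ i, ∑ j, f i j = 1)
    (hcol : ∀ j, ∑ i, f i j = Fintype.card I / Fintype.card J) (jstar : J) :
    ∃ π : I → J, (∀ i, 0 < f i (π i)) ∧
      ({i | π i = jstar} : Finset I).card = Fintype.card I / Fintype.card J ∧
      ∀ j, ({i | π i = j} : Finset I).card = Fintype.card I / Fintype.card J ∨
        ({i | π i = j} : Finset I).card = Fintype.card I / Fintype.card J + 1 := by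
  classical
  set a := Fintype.card I / Fintype.card J with ha
  set r := Fintype.card I % Fintype.card J with hr
  have hJ : 0 < Fintype.card J := Fintype.card_pos_iff.2 ⟨jstar⟩
  have hrq : r < Fintype.card J := Nat.mod_lt _ hJ
  have hI : Fintype.card I = a * Fintype.card J + r := (Nat.div_add_mod' _ _).symm
  let D := Fin (Fintype.card J - 1 - r)
  let Slot := (J × Fin a) ⊕ {j : J // j ≠ jstar}
  let proj : Slot → J := Sum.elim (fun s => s.1) (fun s => s.1)
  let nb : I ⊕ D → Finset Slot := Sum.elim
    (fun i => Finset.univ.filter fun s => 0 < f i (proj s))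
    (fun _ => Finset.univ.map Function.Embedding.inr)
  have hslot : Fintype.card Slot = a * Fintype.card J + (Fintype.card J - 1) := by
    simp [Slot, mul_comm]
  have hall : ∀ S : Finset (I ⊕ D), S.card ≤ (S.biUnion nb).card := by
    intro S
    set T : Finset J := {j | ∃ i ∈ S.toLeft, 0 < f i j} with hT
    have hTJ : T.card ≤ Fintype.card J := T.card_le_univ
    have key := card_mul_card_le hf hrow hcol S.toLeft
    rw [← hT, hI] at key
    have hS : S.card = S.toLeft.card + S.toRight.card :=
      (Finset.card_toLeft_add_card_toRight).symm
    have hman : ∀ j ∈ T, ∀ k : Fin a, (Sum.inl (j, k) : Slot) ∈ S.biUnion nb := by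
      intro j hj k
      obtain ⟨i, hi, hij⟩ := by simpa [hT] using hj
      exact Finset.mem_biUnion.2 ⟨Sum.inl i, hi, by simpa [nb, proj] using hij⟩
    by_cases hd : S.toRight = ∅
    · have hsub : (T ×ˢ Finset.univ).disjSum (T.subtype (· ≠ jstar)) ⊆ S.biUnion nb := by
        intro s hs
        rcases s with ⟨j, k⟩ | ⟨j, hj⟩
        · exact hman j (by simpa using hs) k
        · obtain ⟨i, hi, hij⟩ : ∃ i ∈ S.toLeft, 0 < f i j := by simpa [hT] using hs
          exact Finset.mem_biUnion.2 ⟨Sum.inl i, by simpa using hi, by simpa [nb, proj] using hij⟩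
      have h1 := Finset.card_le_card hsub
      rw [Finset.card_disjSum, Finset.card_product, Finset.card_univ, Fintype.card_fin,
        Finset.card_subtype] at h1
      have h2 : T.card ≤ (T.filter (· ≠ jstar)).card + 1 := by
        rw [Finset.filter_ne']
        exact Nat.sub_le_iff_le_add.1 Finset.pred_card_le_card_erase
      rw [hS, hd, Finset.card_empty, add_zero]
      refine le_trans ?_ h1
      by_contra! hlt
      nlinarith
    · have hsub : (T ×ˢ Finset.univ).disjSum Finset.univ ⊆ S.biUnion nb := by
        intro s hs
        obtain ⟨d, hd⟩ := Finset.nonempty_iff_ne_empty.2 hd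
        rcases s with ⟨j, k⟩ | ⟨j, hj⟩
        · exact hman j (by simpa using hs) k
        · exact Finset.mem_biUnion.2 ⟨Sum.inr d, by simpa using hd, by simp [nb]⟩
      have h1 := Finset.card_le_card hsub
      rw [Finset.card_disjSum, Finset.card_product, Finset.card_univ, Fintype.card_fin,
        Finset.card_univ] at h1
      have h2 : Fintype.card {j : J // j ≠ jstar} = Fintype.card J - 1 := by simp
      have h3 : S.toRight.card ≤ Fintype.card J - 1 - r := by
        simpa [D] using S.toRight.card_le_univ
      have h4 : S.toLeft.card ≤ T.card * a + r := by
        by_contra! hlt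
        nlinarith
      rw [hS]
      omega
  obtain ⟨e, he, hmem⟩ := (Finset.all_card_le_biUnion_card_iff_exists_injective nb).1 hall
  have hbij : Function.Bijective e := by
    refine (Fintype.bijective_iff_injective_and_card e).2 ⟨he, ?_⟩
    rw [hslot, Fintype.card_sum, Fintype.card_fin]
    omega
  have hinl : ∀ s : J × Fin a, ∃ i, e (Sum.inl i) = Sum.inl s := by
    intro s
    obtain ⟨i | d, hi⟩ := hbij.2 (Sum.inl s)
    · exact ⟨i, hi⟩
    · have := hmem (Sum.inr d)
      rw [hi] at this
      simp only [nb, Sum.elim_inr, Finset.mem_map] at this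
      obtain ⟨_, _, h⟩ := this
      cases h
  choose t ht using hinl
  have hlow : ∀ j, a ≤ ({i | proj (e (Sum.inl i)) = j} : Finset I).card := by
    intro j
    have : Function.Injective fun k : Fin a => t (j, k) := by
      intro k k' h
      have := congrArg (fun i => e (Sum.inl i)) h
      simp only [ht] at this
      exact (Prod.mk.inj (Sum.inl_injective this)).2
    calc a = (Finset.univ.image fun k : Fin a => t (j, k)).card := by
          rw [Finset.card_image_of_injective _ this, Finset.card_univ, Fintype.card_fin]
      _ ≤ _ := Finset.card_le_card fun i hi => by
          obtain ⟨k, -, rfl⟩ := Finset.mem_image.1 hi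
          simp [ht, proj]
  have hup : ∀ j, ({i | proj (e (Sum.inl i)) = j} : Finset I).card ≤
      a + if j = jstar then 0 else 1 := by
    intro j
    calc _ ≤ (({j} ×ˢ (Finset.univ : Finset (Fin a))).disjSum
          (({j} : Finset J).subtype (· ≠ jstar))).card := by
          refine Finset.card_le_card_of_injOn (fun i => e (Sum.inl i)) (fun i hi => ?_)
            fun i _ i' _ h => Sum.inl_injective (he h)
          have hi : proj (e (Sum.inl i)) = j := by simpa using hi
          simp only [Finset.mem_coe]
          generalize e (Sum.inl i) = s at hi ⊢
          rcases s with ⟨j', k⟩ | ⟨j', h⟩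
          · simpa [proj, eq_comm] using hi
          · simpa [proj] using hi
      _ ≤ _ := by
          rw [Finset.card_disjSum, Finset.card_product, Finset.card_univ, Fintype.card_fin,
            Finset.card_subtype, Finset.filter_singleton]
          by_cases h : j = jstar <;> simp [h]
  refine ⟨fun i => proj (e (Sum.inl i)), fun i => ?_, ?_, fun j => ?_⟩
  · simpa [nb] using hmem (Sum.inl i)
  · have h1 := hup jstar
    rw [if_pos rfl] at h1
    exact le_antisymm h1 (hlow jstar)
  · have h1 := hup j
    have h2 := hlow j
    simp only
    split_ifs at h1 <;> omega

end Assignment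

section Segments

variable {F : Type*} [DecidableEq F]

/-- The total length of the entries preceding `g` in `u`. -/
def start (x : F → ℝ) (g : F) : List F → ℝ
  | [] => 0
  | a :: u => if a = g then 0 else x a + start x g u

/-- Cutting an interval at the partial sums of `x` along `u`, the part labelled `g`. -/
def segment (u : List F) (x : F → ℝ) (g : F) : Set ℝ :=
  Set.Icc (start x g u) (start x g u + x g)

theorem start_cons_of_ne (x : F → ℝ) {a g : F} (h : a ≠ g) (u : List F) :
    start x g (a :: u) = x a + start x g u := if_neg h

theorem start_cons_self (x : F → ℝ) (a : F) (u : List F) : start x a (a :: u) = 0 := if_pos rfl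

theorem start_nonneg {x : F → ℝ} (hx : ∀ g, 0 ≤ x g) (g : F) (u : List F) :
    0 ≤ start x g u := by
  induction u with
  | nil => exact le_rfl
  | cons a u ih =>
    rw [start]
    split_ifs
    · exact le_rfl
    · exact add_nonneg (hx a) ih

theorem start_of_notMem (x : F → ℝ) {g : F} {u : List F} (hg : g ∉ u) :
    start x g u = (u.map x).sum := by
  induction u with
  | nil => rfl
  | cons a u ih =>
    rw [List.mem_cons, not_or] at hg
    rw [start_cons_of_ne x (Ne.symm hg.1), ih hg.2, List.map_cons, List.sum_cons]

theorem start_add_le {x : F → ℝ} (hx : ∀ g, 0 ≤ x g) {g : F} {u : List F} (hg : g ∈ u) :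
    start x g u + x g ≤ (u.map x).sum := by
  induction u with
  | nil => simp at hg
  | cons a u ih =>
    rw [List.map_cons, List.sum_cons]
    by_cases h : a = g
    · subst h
      rw [start_cons_self]
      have : 0 ≤ (u.map x).sum := List.sum_nonneg (by simpa using fun b _ => hx b)
      linarith
    · rw [start_cons_of_ne x h]
      linarith [ih ((List.mem_cons.1 hg).resolve_left (Ne.symm h))]

theorem start_add_le_or {x : F → ℝ} (hx : ∀ g, 0 ≤ x g) {g h : F} (hgh : g ≠ h) {u : List F}
    (hg : g ∈ u) (hh : h ∈ u) :
    start x g u + x g ≤ start x h u ∨ start x h u + x h ≤ start x g u := by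
  induction u with
  | nil => simp at hg
  | cons a u ih =>
    by_cases h1 : a = g
    · subst h1
      left
      rw [start_cons_self, start_cons_of_ne x hgh]
      linarith [start_nonneg hx h u]
    by_cases h2 : a = h
    · subst h2
      right
      rw [start_cons_self, start_cons_of_ne x h1]
      linarith [start_nonneg hx g u]
    rw [start_cons_of_ne x h1, start_cons_of_ne x h2]
    refine (ih ((List.mem_cons.1 hg).resolve_left (Ne.symm h1))
      ((List.mem_cons.1 hh).resolve_left (Ne.symm h2))).imp ?_ ?_ <;>
    · intro _
      linarith

theorem exists_mem_segment {x : F → ℝ} {u : List F} (hu : u.Nodup)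
    (hne : u ≠ []) {t : ℝ} (h0 : 0 ≤ t) (ht : t ≤ (u.map x).sum) : ∃ g, t ∈ segment u x g := by
  suffices ∃ g ∈ u, t ∈ segment u x g from this.imp fun _ h => h.2
  induction u generalizing t with
  | nil => exact absurd rfl hne
  | cons a u ih =>
    rw [List.map_cons, List.sum_cons] at ht
    rcases le_or_gt t (x a) with h | h
    · refine ⟨a, List.mem_cons_self, ?_, ?_⟩ <;> rw [start_cons_self]
      · exact h0
      · linarith
    rcases eq_or_ne u [] with rfl | hu0
    · simp at ht
      linarith
    obtain ⟨g, hg, h1, h2⟩ := ih hu.of_cons hu0 (t := t - x a) (by linarith) (by linarith)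
    have hag : a ≠ g := by
      rintro rfl
      exact (List.nodup_cons.1 hu).1 hg
    refine ⟨g, List.mem_cons_of_mem _ hg, ?_, ?_⟩ <;> rw [start_cons_of_ne x hag] <;> linarith

theorem segment_inter_finite {x : F → ℝ} (hx : ∀ g, 0 ≤ x g) {g h : F} (hgh : g ≠ h)
    {u : List F} (hg : g ∈ u) (hh : h ∈ u) : (segment u x g ∩ segment u x h).Finite := by
  refine Set.Subsingleton.finite fun s hs t ht => ?_
  obtain ⟨⟨h1, h2⟩, h3, h4⟩ := hs
  obtain ⟨⟨h5, h6⟩, h7, h8⟩ := ht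
  rcases start_add_le_or hx hgh hg hh with h | h <;> linarith

theorem interior_segment_inter {x : F → ℝ} (hx : ∀ g, 0 ≤ x g) {g h : F} (hgh : g ≠ h)
    {u : List F} (hu : ∀ g, x g ≠ 0 → g ∈ u) :
    interior (segment u x g) ∩ interior (segment u x h) = ∅ := by
  rw [segment, segment, interior_Icc, interior_Icc]
  by_cases h1 : x g = 0
  · simp [h1]
  by_cases h2 : x h = 0
  · simp [h2]
  rw [Set.eq_empty_iff_forall_notMem]
  rintro t ⟨⟨h3, h4⟩, h5, h6⟩
  rcases start_add_le_or hx hgh (hu g h1) (hu h h2) with h | h <;> linarith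

theorem start_filter (x : F → ℝ) (u : List F) {g : F} (hg : x g ≠ 0) :
    start x g (u.filter fun h => x h ≠ 0) = start x g u := by
  induction u with
  | nil => rfl
  | cons a u ih =>
    by_cases h : a = g
    · subst h
      rw [List.filter_cons_of_pos (by simpa using hg), start_cons_self, start_cons_self]
    · rw [start_cons_of_ne x h]
      by_cases ha : x a = 0
      · rw [List.filter_cons_of_neg (by simpa using ha), ih, ha, zero_add]
      · rw [List.filter_cons_of_pos (by simpa using ha), start_cons_of_ne x h, ih]

theorem abs_start_sub_le {x y : F → ℝ} {d : ℝ} (hd : ∀ g, |x g - y g| ≤ d) (g : F) (u : List F) :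
    |start x g u - start y g u| ≤ u.length * d := by
  have hd0 : 0 ≤ d := (abs_nonneg _).trans (hd g)
  induction u with
  | nil => simp [start]
  | cons a u ih =>
    rw [List.length_cons, Nat.cast_succ, add_mul, one_mul]
    by_cases h : a = g
    · subst h
      rw [start_cons_self, start_cons_self, sub_zero, abs_zero]
      positivity
    · rw [start_cons_of_ne x h, start_cons_of_ne y h, add_sub_add_comm, add_comm (_ * d)]
      exact (abs_add_le _ _).trans (add_le_add (hd a) ih)

theorem start_eq_sum_take (x : F → ℝ) (g : F) (u : List F) :
    start x g u = ((u.take (u.idxOf g)).map x).sum := by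
  induction u with
  | nil => rfl
  | cons a u ih =>
    by_cases h : a = g
    · subst h
      simp [start_cons_self]
    · rw [start_cons_of_ne x h, List.idxOf_cons_ne _ h, List.take_succ_cons, List.map_cons,
        List.sum_cons, ih]

theorem start_map_add [AddGroup F] (x : F → ℝ) (g h : F) (u : List F) :
    start (fun y => x (y - h)) g (u.map (· + h)) = start x (g - h) u := by
  induction u with
  | nil => rfl
  | cons a u ih =>
    rw [List.map_cons, start, start, ih, add_sub_cancel_right]
    simp only [eq_sub_iff_add_eq]

theorem segment_map_add [AddGroup F] (x : F → ℝ) (g h : F) (u : List F) :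
    segment (u.map (· + h)) (fun y => x (y - h)) g = segment u x (g - h) := by
  rw [segment, segment, start_map_add]

theorem sum_map_eq_one [Fintype F] {x : F → ℝ} (hx : x ∈ stdSimplex ℝ F) {u : List F}
    (hu : u.Nodup) (hs : ∀ g, x g ≠ 0 → g ∈ u) : (u.map x).sum = 1 := by
  rw [← List.sum_toFinset x hu, ← hx.2]
  refine Finset.sum_subset (Finset.subset_univ _) fun g _ hg => ?_
  by_contra h
  exact hg (List.mem_toFinset.2 (hs g h))

theorem segment_subset [Fintype F] {x : F → ℝ} (hx : x ∈ stdSimplex ℝ F) {u : List F}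
    (hu : u.Nodup) (hs : ∀ g, x g ≠ 0 → g ∈ u) (g : F) :
    0 ≤ start x g u ∧ start x g u + x g ≤ 1 := by
  refine ⟨start_nonneg hx.1 g u, ?_⟩
  rw [← sum_map_eq_one hx hu hs]
  by_cases hg : g ∈ u
  · exact start_add_le hx.1 hg
  · rw [start_of_notMem x hg, by_contra fun h => hg (hs g h), add_zero]

theorem iUnion_segment [Fintype F] {x : F → ℝ} (hx : x ∈ stdSimplex ℝ F) {u : List F}
    (hu : u.Nodup) (hs : ∀ g, x g ≠ 0 → g ∈ u) : ⋃ g, segment u x g = Set.Icc 0 1 := by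
  have h1 := sum_map_eq_one hx hu hs
  refine Set.Subset.antisymm (Set.iUnion_subset fun g => ?_) fun t ht => ?_
  · have := segment_subset hx hu hs g
    exact Set.Icc_subset_Icc this.1 this.2
  · refine Set.mem_iUnion.2 (exists_mem_segment hu ?_ ht.1 (h1 ▸ ht.2))
    rintro rfl
    simp at h1

theorem length_eq_of_nodup [Fintype F] {q : ℕ} (ι : Fin q ≃ F) {u : List F} (hu : u.Nodup)
    (hall : ∀ g, g ∈ u) : u.length = q := by
  rw [← List.toFinset_card_of_nodup hu, Finset.eq_univ_iff_forall.2 fun g =>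
    List.mem_toFinset.2 (hall g), Finset.card_univ, ← Fintype.card_congr ι, Fintype.card_fin]

theorem volume_symmDiff_Icc_le (a b a' b' : ℝ) :
    (volume (symmDiff (Set.Icc a b) (Set.Icc a' b'))).toReal ≤ |a - a'| + |b - b'| := by
  have hsub : symmDiff (Set.Icc a b) (Set.Icc a' b') ⊆ Set.uIcc a' a ∪ Set.uIcc b' b := by
    rintro t (⟨⟨h1, h2⟩, h3⟩ | ⟨⟨h1, h2⟩, h3⟩)
    · rcases lt_or_ge t a' with h | h
      · exact Or.inl (Set.mem_uIcc.2 (Or.inr ⟨h1, h.le⟩))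
      · exact Or.inr (Set.mem_uIcc.2 (Or.inl ⟨(not_le.1 fun h' => h3 ⟨h, h'⟩).le, h2⟩))
    · rcases lt_or_ge t a with h | h
      · exact Or.inl (Set.mem_uIcc.2 (Or.inl ⟨h1, h.le⟩))
      · exact Or.inr (Set.mem_uIcc.2 (Or.inr ⟨(not_le.1 fun h' => h3 ⟨h, h'⟩).le, h2⟩))
  refine ENNReal.toReal_le_of_le_ofReal (by positivity) ?_
  calc volume (symmDiff (Set.Icc a b) (Set.Icc a' b'))
      ≤ volume (Set.uIcc a' a) + volume (Set.uIcc b' b) :=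
        (measure_mono hsub).trans (measure_union_le _ _)
    _ = ENNReal.ofReal (|a - a'| + |b - b'|) := by
      rw [Real.volume_interval, Real.volume_interval, ENNReal.ofReal_add (abs_nonneg _) (abs_nonneg _)]

theorem volume_symmDiff_segment_filter (u : List F) (x : F → ℝ) (g : F) :
    (volume (symmDiff (segment (u.filter fun h => x h ≠ 0) x g) (segment u x g))).toReal = 0 := by
  by_cases hg : x g = 0
  · have h : volume (symmDiff (segment (u.filter fun h => x h ≠ 0) x g) (segment u x g)) = 0 := by
      refine measure_mono_null symmDiff_le_sup (measure_union_null ?_ ?_) <;> simp [segment, hg]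
    rw [h, ENNReal.toReal_zero]
  · rw [segment, segment, start_filter x u hg, symmDiff_self]
    simp

theorem volume_symmDiff_segment_le {x y : F → ℝ} {d : ℝ} (hd : ∀ g, |x g - y g| ≤ d) (u : List F)
    (g : F) : (volume (symmDiff (segment u x g) (segment u y g))).toReal ≤
      (2 * u.length + 1) * d := by
  refine (volume_symmDiff_Icc_le _ _ _ _).trans ?_
  have h1 := abs_start_sub_le hd g u
  have h2 := abs_add_le (start x g u - start y g u) (x g - y g)
  rw [← add_sub_add_comm] at h2
  linarith [hd g]

end Segments

section Metric

variable {m q : ℕ} {A B C : Fin q → Fin m → Set ℝ}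

theorem _root_.IsMultiDivision.subset (hA : IsMultiDivision A) (j : Fin q) (ℓ : Fin m) :
    A j ℓ ⊆ Set.Icc 0 1 := by
  rw [← hA.2.1 ℓ]
  exact Set.subset_iUnion (fun j => A j ℓ) j

theorem _root_.IsMultiDivision.comp_perm (hA : IsMultiDivision A) (ρ : Equiv.Perm (Fin q)) :
    IsMultiDivision fun j => A (ρ j) := by
  refine ⟨fun j => hA.1 _, fun ℓ => ?_, fun j j' h => hA.2.2 _ _ (ρ.injective.ne h)⟩
  rw [← hA.2.1 ℓ]
  exact ρ.surjective.iUnion_comp fun j => A j ℓ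

/-- The sum of the distances between the entries of two multi-divisions. -/
noncomputable def multiDist (A B : Fin q → Fin m → Set ℝ) : ℝ := ∑ j, layeredDist (A j) (B j)

theorem layeredDist_nonneg (L L' : Fin m → Set ℝ) : 0 ≤ layeredDist L L' :=
  Finset.sum_nonneg fun _ _ => ENNReal.toReal_nonneg

theorem multiDist_nonneg (A B : Fin q → Fin m → Set ℝ) : 0 ≤ multiDist A B :=
  Finset.sum_nonneg fun _ _ => layeredDist_nonneg _ _

theorem layeredDist_le_multiDist (A B : Fin q → Fin m → Set ℝ) (j : Fin q) :
    layeredDist (A j) (B j) ≤ multiDist A B :=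
  Finset.single_le_sum (f := fun j => layeredDist (A j) (B j))
    (fun _ _ => layeredDist_nonneg _ _) (Finset.mem_univ j)

theorem multiDist_self (A : Fin q → Fin m → Set ℝ) : multiDist A A = 0 := by
  simp [multiDist, layeredDist]

theorem multiDist_comm (A B : Fin q → Fin m → Set ℝ) : multiDist A B = multiDist B A := by
  simp [multiDist, layeredDist, symmDiff_comm]

theorem multiDist_comp_perm (A B : Fin q → Fin m → Set ℝ) (ρ : Equiv.Perm (Fin q)) :
    multiDist (fun j => A (ρ j)) (fun j => B (ρ j)) = multiDist A B :=
  Equiv.sum_comp ρ fun j => layeredDist (A j) (B j)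

theorem multiDist_triangle (hA : IsMultiDivision A) (hB : IsMultiDivision B)
    (hC : IsMultiDivision C) : multiDist A C ≤ multiDist A B + multiDist B C := by
  rw [multiDist, multiDist, multiDist, ← Finset.sum_add_distrib]
  refine Finset.sum_le_sum fun j _ => ?_
  rw [layeredDist, layeredDist, layeredDist, ← Finset.sum_add_distrib]
  refine Finset.sum_le_sum fun ℓ _ => ?_
  have hfin : ∀ {S T : Set ℝ}, S ⊆ Set.Icc 0 1 → T ⊆ Set.Icc 0 1 → volume (symmDiff S T) ≠ ⊤ :=
    fun hS hT => measure_ne_top_of_subset (symmDiff_le_sup.trans (sup_le hS hT)) (by simp)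
  rw [← ENNReal.toReal_add (hfin (hA.subset j ℓ) (hB.subset j ℓ))
    (hfin (hB.subset j ℓ) (hC.subset j ℓ))]
  refine ENNReal.toReal_mono (ENNReal.add_ne_top.2 ⟨hfin (hA.subset j ℓ) (hB.subset j ℓ),
    hfin (hB.subset j ℓ) (hC.subset j ℓ)⟩) ?_
  exact (measure_mono (symmDiff_triangle _ _ _)).trans (measure_union_le _ _)

/-- The distance from `B` to the multi-divisions at which `j` is preferred. -/
noncomputable def prefDist (c : (Fin q → Fin m → Set ℝ) → Set (Fin q))
    (B : Fin q → Fin m → Set ℝ) (j : Fin q) : ℝ :=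
  sInf {d | ∃ A, IsMultiDivision A ∧ j ∈ c A ∧ d = multiDist A B}

variable {c : (Fin q → Fin m → Set ℝ) → Set (Fin q)}

theorem prefDist_nonneg (c : (Fin q → Fin m → Set ℝ) → Set (Fin q))
    (B : Fin q → Fin m → Set ℝ) (j : Fin q) : 0 ≤ prefDist c B j :=
  Real.sInf_nonneg (by rintro _ ⟨A, -, -, rfl⟩; exact multiDist_nonneg A B)

theorem prefDist_le (hA : IsMultiDivision A) {j : Fin q} (hj : j ∈ c A) :
    prefDist c B j ≤ multiDist A B :=
  csInf_le ⟨0, by rintro _ ⟨A, -, -, rfl⟩; exact multiDist_nonneg A B⟩ ⟨A, hA, hj, rfl⟩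

theorem prefDist_eq_zero (hB : IsMultiDivision B) {j : Fin q} (hj : j ∈ c B) :
    prefDist c B j = 0 :=
  le_antisymm ((prefDist_le hB hj).trans_eq (multiDist_self B)) (prefDist_nonneg c B j)

/-- Permuting the entries of a multi-division permutes the preferred indices. -/
def PermInvariant (c : (Fin q → Fin m → Set ℝ) → Set (Fin q)) : Prop :=
  ∀ (ρ : Equiv.Perm (Fin q)) (A : Fin q → Fin m → Set ℝ) (j : Fin q),
    j ∈ c (fun j' => A (ρ j')) ↔ ρ j ∈ c A

theorem prefDist_comp_perm (hc : PermInvariant c) (ρ : Equiv.Perm (Fin q))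
    (B : Fin q → Fin m → Set ℝ) (j : Fin q) :
    prefDist c (fun j' => B (ρ j')) j = prefDist c B (ρ j) := by
  unfold prefDist
  congr 1
  ext d
  constructor
  · rintro ⟨A, hA, hj, rfl⟩
    refine ⟨fun j => A (ρ.symm j), hA.comp_perm ρ.symm, (hc _ _ _).2 (by simpa using hj), ?_⟩
    rw [← multiDist_comp_perm _ B ρ]
    simp
  · rintro ⟨A, hA, hj, rfl⟩
    exact ⟨fun j => A (ρ j), hA.comp_perm ρ, (hc _ _ _).2 hj, (multiDist_comp_perm A B ρ).symm⟩

theorem prefDist_set_nonempty (hc : PermInvariant c)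
    (hne : ∀ A, IsMultiDivision A → (c A).Nonempty) (hB : IsMultiDivision B)
    (C : Fin q → Fin m → Set ℝ) (j : Fin q) :
    {d | ∃ A, IsMultiDivision A ∧ j ∈ c A ∧ d = multiDist A C}.Nonempty := by
  obtain ⟨j', hj'⟩ := hne B hB
  exact ⟨_, fun i => B (Equiv.swap j j' i), hB.comp_perm _, (hc _ _ _).2 (by simpa using hj'), rfl⟩

theorem exists_multiDist_lt (hc : PermInvariant c)
    (hne : ∀ A, IsMultiDivision A → (c A).Nonempty) (hB : IsMultiDivision B) {j : Fin q} {δ : ℝ}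
    (hδ : prefDist c B j < δ) : ∃ A, IsMultiDivision A ∧ j ∈ c A ∧ multiDist A B < δ := by
  obtain ⟨_, ⟨A, hA, hj, rfl⟩, hlt⟩ :=
    exists_lt_of_csInf_lt (prefDist_set_nonempty hc hne hB B j) hδ
  exact ⟨A, hA, hj, hlt⟩

theorem prefDist_le_add (hc : PermInvariant c)
    (hne : ∀ A, IsMultiDivision A → (c A).Nonempty) (hB : IsMultiDivision B)
    (hC : IsMultiDivision C) (j : Fin q) :
    prefDist c B j ≤ prefDist c C j + multiDist B C := by
  rw [← sub_le_iff_le_add]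
  refine le_csInf (prefDist_set_nonempty hc hne hB C j) ?_
  rintro _ ⟨A, hA, hj, rfl⟩
  have h1 := prefDist_le (B := B) hA hj
  have h2 := multiDist_triangle hA hC hB
  rw [multiDist_comm C B] at h2
  linarith

theorem abs_prefDist_sub_le (hc : PermInvariant c)
    (hne : ∀ A, IsMultiDivision A → (c A).Nonempty) (hB : IsMultiDivision B)
    (hC : IsMultiDivision C) (j : Fin q) :
    |prefDist c B j - prefDist c C j| ≤ multiDist B C := by
  have h1 := prefDist_le_add hc hne hB hC j
  have h2 := prefDist_le_add hc hne hC hB j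
  rw [multiDist_comm C B] at h2
  rw [abs_le]
  constructor <;> linarith

/-- A positive weight on the entries that are preferred at some multi-division nearby. -/
noncomputable def weight (ε : ℝ) (c : (Fin q → Fin m → Set ℝ) → Set (Fin q))
    (B : Fin q → Fin m → Set ℝ) (j : Fin q) : ℝ := max 0 (ε - prefDist c B j)

/-- The weights, normalised to have sum one. -/
noncomputable def share (ε : ℝ) (c : (Fin q → Fin m → Set ℝ) → Set (Fin q))
    (B : Fin q → Fin m → Set ℝ) (j : Fin q) : ℝ := weight ε c B j / ∑ i, weight ε c B i

theorem weight_nonneg (ε : ℝ) (c : (Fin q → Fin m → Set ℝ) → Set (Fin q))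
    (B : Fin q → Fin m → Set ℝ) (j : Fin q) : 0 ≤ weight ε c B j := le_max_left _ _

theorem share_nonneg (ε : ℝ) (c : (Fin q → Fin m → Set ℝ) → Set (Fin q))
    (B : Fin q → Fin m → Set ℝ) (j : Fin q) : 0 ≤ share ε c B j :=
  div_nonneg (weight_nonneg ε c B j) (Finset.sum_nonneg fun i _ => weight_nonneg ε c B i)

theorem share_comp_perm (hc : PermInvariant c) (ε : ℝ) (ρ : Equiv.Perm (Fin q))
    (B : Fin q → Fin m → Set ℝ) (j : Fin q) :
    share ε c (fun j' => B (ρ j')) j = share ε c B (ρ j) := by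
  simp only [share, weight, prefDist_comp_perm hc]
  rw [Equiv.sum_comp ρ fun i => max 0 (ε - prefDist c B i)]

theorem le_sum_weight (hne : ∀ A, IsMultiDivision A → (c A).Nonempty) (hB : IsMultiDivision B)
    (ε : ℝ) : ε ≤ ∑ i, weight ε c B i := by
  obtain ⟨j, hj⟩ := hne B hB
  calc ε ≤ weight ε c B j := by simp [weight, prefDist_eq_zero hB hj]
    _ ≤ _ := Finset.single_le_sum (f := weight ε c B) (fun i _ => weight_nonneg ε c B i)
      (Finset.mem_univ j)

theorem sum_share (hne : ∀ A, IsMultiDivision A → (c A).Nonempty) (hB : IsMultiDivision B)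
    {ε : ℝ} (hε : 0 < ε) : ∑ j, share ε c B j = 1 := by
  simp only [share]
  rw [← Finset.sum_div, div_self (hε.trans_le (le_sum_weight hne hB ε)).ne']

theorem prefDist_lt_of_share_pos {ε : ℝ} {j : Fin q} (h : 0 < share ε c B j) :
    prefDist c B j < ε := by
  by_contra! hle
  have : weight ε c B j = 0 := max_eq_left (by linarith)
  simp [share, this] at h

theorem abs_share_sub_le (hc : PermInvariant c) (hne : ∀ A, IsMultiDivision A → (c A).Nonempty)
    (hB : IsMultiDivision B) (hC : IsMultiDivision C) {ε : ℝ} (hε : 0 < ε) (j : Fin q) :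
    |share ε c B j - share ε c C j| ≤ (q + 1) / ε * multiDist B C := by
  have hw : ∀ j, |weight ε c B j - weight ε c C j| ≤ multiDist B C := fun j => by
    rw [weight, weight, max_comm 0, max_comm 0]
    refine (abs_max_sub_max_le_abs _ _ _).trans ?_
    rw [sub_sub_sub_cancel_left, abs_sub_comm]
    exact abs_prefDist_sub_le hc hne hB hC j
  have hW : |∑ i, weight ε c B i - ∑ i, weight ε c C i| ≤ q * multiDist B C := by
    rw [← Finset.sum_sub_distrib]
    refine (Finset.abs_sum_le_sum_abs _ _).trans ((Finset.sum_le_sum fun i _ => hw i).trans_eq ?_)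
    simp
  have hB0 := le_sum_weight hne hB ε
  have hC0 := le_sum_weight hne hC ε
  have hle : weight ε c C j ≤ ∑ i, weight ε c C i :=
    Finset.single_le_sum (f := weight ε c C) (fun i _ => weight_nonneg ε c C i) (Finset.mem_univ j)
  have h0 := weight_nonneg ε c C j
  have hwj := hw j
  rw [share, share]
  generalize ∑ i, weight ε c B i = W at *
  generalize ∑ i, weight ε c C i = V at *
  generalize weight ε c B j = w at *
  generalize weight ε c C j = v at *
  generalize multiDist B C = d at *
  have hW0 : 0 < W := hε.trans_le hB0
  have hV0 : 0 < V := hε.trans_le hC0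
  have hd : 0 ≤ d := (abs_nonneg _).trans hwj
  have key : w / W - v / V = ((w - v) - v / V * (W - V)) / W := by
    field_simp
    ring
  have hv : |v / V| ≤ 1 := by
    rw [abs_of_nonneg (div_nonneg h0 hV0.le)]
    exact (div_le_one hV0).2 hle
  rw [key, abs_div, abs_of_pos hW0, div_mul_eq_mul_div (q + 1 : ℝ)]
  refine div_le_div₀ (by positivity) ?_ hε hB0
  calc |w - v - v / V * (W - V)| ≤ |w - v| + |v / V * (W - V)| := abs_sub _ _
    _ ≤ d + 1 * (q * d) := by
      rw [abs_mul]
      gcongr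
    _ = (q + 1) * d := by ring

end Metric

section Division

variable {F : Type*} [Field F] [DecidableEq F] {m q : ℕ} {ι : Fin q ≃ F} {s : Fin m → F}

/-- Cut every layer at the partial sums of `x` along `u`; the entry `j` receives from the layer `ℓ`
the segment labelled `ι j + s ℓ`. -/
def division (ι : Fin q ≃ F) (s : Fin m → F) (u : List F) (x : F → ℝ) : Fin q → Fin m → Set ℝ :=
  fun j ℓ => segment u x (ι j + s ℓ)

theorem division_map_add (u : List F) (x : F → ℝ) (h : F) :
    division ι s (u.map (· + h)) (fun y => x (y - h)) =
      fun j => division ι s u x (((ι.trans (Equiv.subRight h)).trans ι.symm) j) := by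
  funext j ℓ
  simp only [division, segment_map_add, Equiv.trans_apply, Equiv.subRight_apply,
    Equiv.apply_symm_apply]
  rw [add_sub_right_comm]

theorem isContiguous_division (u : List F) (x : F → ℝ) (j : Fin q) :
    IsContiguous (division ι s u x j) := fun _ => ⟨_, _, rfl⟩

theorem isNonOverlapping_division (hs : Function.Injective s) {u : List F} (hu : ∀ g, g ∈ u)
    {x : F → ℝ} (hx : ∀ g, 0 ≤ x g) (j : Fin q) : IsNonOverlapping (division ι s u x j) :=
  fun _ _ h => segment_inter_finite hx (fun h' => h (hs (add_left_cancel h'))) (hu _) (hu _)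

theorem multiDist_division_filter (u : List F) (x : F → ℝ) :
    multiDist (division ι s (u.filter fun h => x h ≠ 0) x) (division ι s u x) = 0 :=
  Finset.sum_eq_zero fun _ _ => Finset.sum_eq_zero fun _ _ =>
    volume_symmDiff_segment_filter u x _

theorem multiDist_division_le {x y : F → ℝ} {d : ℝ} (hd : ∀ g, |x g - y g| ≤ d) (u : List F) :
    multiDist (division ι s u x) (division ι s u y) ≤ q * (m * ((2 * u.length + 1) * d)) := by
  refine (Finset.sum_le_sum fun j _ =>
    Finset.sum_le_sum fun ℓ _ => volume_symmDiff_segment_le hd u (ι j + s ℓ)).trans_eq ?_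
  simp

variable [Fintype F]

theorem isMultiDivision_division {x : F → ℝ} (hx : x ∈ stdSimplex ℝ F) {u : List F}
    (hu : u.Nodup) (hs : ∀ g, x g ≠ 0 → g ∈ u) : IsMultiDivision (division ι s u x) := by
  refine ⟨fun j ℓ => ?_, fun ℓ => ?_, fun j j' h ℓ => ?_⟩
  · exact ⟨{(_, _)}, by simpa using segment_subset hx hu hs (ι j + s ℓ), by
      simp [division, segment]⟩
  · rw [← iUnion_segment hx hu hs]
    exact (ι.trans (Equiv.addRight (s ℓ))).surjective.iUnion_comp fun g => segment u x g
  · exact interior_segment_inter hx.1 (fun h' => h (ι.injective (add_right_cancel h'))) hs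

theorem isLongKnifeDivision_division {x : F → ℝ} (hx : x ∈ stdSimplex ℝ F) {u : List F}
    (hu : u.Nodup) (hall : ∀ g, g ∈ u) : IsLongKnifeDivision (division ι s u x) := by
  have hlen := length_eq_of_nodup ι hu hall
  let τ : F → Fin q := fun g => ⟨u.idxOf g, hlen ▸ List.idxOf_lt_length_of_mem (hall g)⟩
  have hτ : Function.Injective τ := fun g h hgh =>
    (List.idxOf_inj (hall g)).1 (Fin.val_eq_of_eq hgh)
  have hinj : ∀ ℓ, Function.Injective fun j => τ (ι j + s ℓ) := fun ℓ j j' h =>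
    ι.injective (add_right_cancel (hτ h))
  refine ⟨fun i => ((u.take i).map x).sum, fun i i' h => ?_, by simp, ?_,
    fun ℓ => Equiv.ofBijective _ (Finite.injective_iff_bijective.1 (hinj ℓ)), fun ℓ j => ?_⟩
  · exact List.Sublist.sum_le_sum ((List.take_sublist_take_left h).map x)
      (List.forall_mem_map.2 fun g _ => hx.1 g)
  · simp only
    rw [Fin.val_last, ← hlen, List.take_length, sum_map_eq_one hx hu fun g _ => hall g]
  · simp only [division, segment, start_eq_sum_take, Equiv.ofBijective_apply, Fin.val_castSucc,
      Fin.val_succ, τ]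
    rw [List.take_add_one, List.getElem?_idxOf (hall _)]
    simp

end Division

section Approximation

variable {F : Type*} [Field F] [Fintype F] [DecidableEq F] {m q : ℕ} {ι : Fin q ≃ F}
  {s : Fin m → F} {I : Type*} [Fintype I] {c : I → (Fin q → Fin m → Set ℝ) → Set (Fin q)}

/-- There are divisions for which all the column sums of the shares are almost equal. -/
theorem exists_division_le_sum_share {p : ℕ} [Fact p.Prime] [Algebra (ZMod p) F]
    (hc : ∀ i, PermInvariant (c i)) (hne : ∀ i A, IsMultiDivision A → (c i A).Nonempty)
    {ε δ : ℝ} (hε : 0 < ε) (hδ : 0 < δ) :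
    ∃ u : List F, u.Nodup ∧ (∀ g, g ∈ u) ∧ ∃ x ∈ stdSimplex ℝ F, ∀ j,
      Fintype.card I / q - δ ≤ ∑ i, share ε (c i) (division ι s u x) j := by
  have hq : 0 < q := Fin.pos (ι.symm 0)
  let M : List F → (F → ℝ) → Set F := fun v x =>
    {g | (Fintype.card I / q : ℝ) ≤ ∑ i, share ε (c i) (division ι s v x) (ι.symm g)}
  have hM : ∀ v x h g, g ∈ M (v.map (· + h)) (fun y => x (y - h)) ↔ g - h ∈ M v x := by
    intro v x h g
    simp only [M, Set.mem_ofPred_eq]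
    rw [division_map_add]
    simp only [share_comp_perm (hc _)]
    simp
  have hMne : ∀ v x, v.Nodup → x ∈ stdSimplex ℝ F → (∀ g, x g ≠ 0 ↔ g ∈ v) →
      (M v x).Nonempty := by
    intro v x hv hx hsupp
    have hdiv : IsMultiDivision (division ι s v x) :=
      isMultiDivision_division hx hv fun g hg => (hsupp g).1 hg
    obtain ⟨j, -, hj⟩ := Finset.exists_le_of_sum_le (s := Finset.univ)
      (f := fun _ : Fin q => (Fintype.card I / q : ℝ))
      (g := fun j => ∑ i, share ε (c i) (division ι s v x) j) ⟨ι.symm 0, Finset.mem_univ _⟩ (by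
        rw [Finset.sum_comm]
        simp only [sum_share (hne _) hdiv hε, Finset.sum_const, Finset.card_univ, nsmul_eq_mul,
          Fintype.card_fin, mul_one]
        rw [mul_div_cancel₀ _ (by positivity)])
    exact ⟨ι j, by simpa [M] using hj⟩
  set K : ℝ := Fintype.card I * ((q + 1) / ε * (q * (m * (2 * q + 1)))) with hK
  have hK0 : 0 ≤ K := by positivity
  obtain ⟨u, hu, hall, P, hP, hd, hmem⟩ :=
    Chain.exists_small_of_mem (p := p) hM hMne (ε := δ / (K + 1)) (by positivity)
  refine ⟨u, hu, hall, P 0, hP 0, fun j => ?_⟩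
  have h1 : Fintype.card I / q ≤ ∑ i, share ε (c i)
      (division ι s (u.filter fun h => P (ι j) h ≠ 0) (P (ι j))) j := by
    simpa [M] using hmem (ι j)
  have hdist : multiDist (division ι s (u.filter fun h => P (ι j) h ≠ 0) (P (ι j)))
      (division ι s u (P 0)) ≤ q * (m * ((2 * q + 1) * (δ / (K + 1)))) := by
    have hfull : ∀ x ∈ stdSimplex ℝ F, IsMultiDivision (division ι s u x) := fun x hx =>
      isMultiDivision_division hx hu fun g _ => hall g
    refine (multiDist_triangle (isMultiDivision_division (hP _) (hu.filter _) fun g hg => by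
      simpa [hall] using hg) (hfull _ (hP (ι j))) (hfull _ (hP 0))).trans ?_
    rw [multiDist_division_filter, zero_add]
    refine (multiDist_division_le (d := δ / (K + 1)) (fun g => ?_) u).trans_eq (by
      rw [length_eq_of_nodup ι hu hall])
    exact ((dist_le_pi_dist (P (ι j)) (P 0) g).trans_lt (hd _ _)).le
  have h2 : ∑ i, share ε (c i) (division ι s (u.filter fun h => P (ι j) h ≠ 0) (P (ι j))) j ≤
      ∑ i, (share ε (c i) (division ι s u (P 0)) j +
        (q + 1) / ε * (q * (m * ((2 * q + 1) * (δ / (K + 1)))))) := by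
    refine Finset.sum_le_sum fun i _ => ?_
    have := abs_share_sub_le (hc i) (hne i)
      (isMultiDivision_division (ι := ι) (s := s) (hP (ι j))
        (hu.filter fun h => P (ι j) h ≠ 0) fun g hg => by simpa [hall] using hg)
      (isMultiDivision_division (ι := ι) (s := s) (hP 0) hu fun g _ => hall g) hε j
    have h3 : (q + 1) / ε * multiDist
        (division ι s (u.filter fun h => P (ι j) h ≠ 0) (P (ι j))) (division ι s u (P 0)) ≤
        (q + 1) / ε * (q * (m * ((2 * q + 1) * (δ / (K + 1))))) := by gcongr
    linarith [le_abs_self (share ε (c i)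
      (division ι s (u.filter fun h => P (ι j) h ≠ 0) (P (ι j))) j -
      share ε (c i) (division ι s u (P 0)) j)]
  have h4 : Fintype.card I * ((q + 1) / ε * (q * (m * ((2 * q + 1) * (δ / (K + 1)))))) ≤ δ := by
    have : Fintype.card I * ((q + 1) / ε * (q * (m * ((2 * q + 1) * (δ / (K + 1)))))) =
        K * δ / (K + 1) := by
      rw [hK]
      ring
    rw [this, div_le_iff₀ (by positivity)]
    nlinarith
  rw [Finset.sum_add_distrib, Finset.sum_const, Finset.card_univ, nsmul_eq_mul] at h2
  linarith

end Approximation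

section Limit

open Filter Topology

/-- Closed preferences: an index preferred along a convergent sequence is preferred in the limit. -/
def PrefClosed {m q : ℕ} (c : (Fin q → Fin m → Set ℝ) → Set (Fin q)) : Prop :=
  ∀ (A : ℕ → Fin q → Fin m → Set ℝ) (B : Fin q → Fin m → Set ℝ),
    (∀ t, IsMultiDivision (A t)) → IsMultiDivision B →
    (∀ j, Tendsto (fun t => layeredDist (A t j) (B j)) atTop (𝓝 0)) →
    ∀ j, (∀ t, j ∈ c (A t)) → j ∈ c B

theorem mem_of_prefDist_eq_zero {m q : ℕ} {c : (Fin q → Fin m → Set ℝ) → Set (Fin q)}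
    (hc : PermInvariant c) (hne : ∀ A, IsMultiDivision A → (c A).Nonempty) (hcl : PrefClosed c)
    {B : Fin q → Fin m → Set ℝ} (hB : IsMultiDivision B) {j : Fin q} (h : prefDist c B j = 0) :
    j ∈ c B := by
  have hex : ∀ t : ℕ, ∃ A, IsMultiDivision A ∧ j ∈ c A ∧ multiDist A B < 1 / ((t : ℝ) + 1) :=
    fun t => exists_multiDist_lt hc hne hB (h ▸ by positivity)
  choose A hA hj hlt using hex
  refine hcl A B hA hB (fun i => ?_) j hj
  exact squeeze_zero (fun t => layeredDist_nonneg _ _)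
    (fun t => (layeredDist_le_multiDist _ _ i).trans (hlt t).le)
    tendsto_one_div_add_atTop_nhds_zero_nat

variable {F : Type*} [Field F] [Fintype F] [DecidableEq F] {m q : ℕ} {ι : Fin q ≃ F}
  {s : Fin m → F} {I : Type*} [Fintype I] {c : I → (Fin q → Fin m → Set ℝ) → Set (Fin q)}

/-- There is a division with a fractional assignment of the agents to preferred entries for which
all the column sums are equal. -/
theorem exists_division_fractional {p : ℕ} [Fact p.Prime] [Algebra (ZMod p) F]
    (hc : ∀ i, PermInvariant (c i)) (hne : ∀ i A, IsMultiDivision A → (c i A).Nonempty)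
    (hcl : ∀ i, PrefClosed (c i)) :
    ∃ u : List F, u.Nodup ∧ (∀ g, g ∈ u) ∧ ∃ x ∈ stdSimplex ℝ F, ∃ f : I → Fin q → ℝ,
      (∀ i j, 0 ≤ f i j) ∧ (∀ i, ∑ j, f i j = 1) ∧ (∀ j, ∑ i, f i j = Fintype.card I / q) ∧
      ∀ i j, 0 < f i j → j ∈ c i (division ι s u x) := by
  have hq : 0 < q := Fin.pos (ι.symm 0)
  have hex := fun t : ℕ => exists_division_le_sum_share (ι := ι) (s := s) (p := p) hc hne
    (ε := 1 / ((t : ℝ) + 1)) (δ := 1 / ((t : ℝ) + 1)) (by positivity) (by positivity)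
  choose v hv hall y hy hcol using hex
  have hdiv : ∀ t, IsMultiDivision (division ι s (v t) (y t)) := fun t =>
    isMultiDivision_division (hy t) (hv t) fun g _ => hall t g
  let φ : ℕ → I → Fin q → ℝ := fun t i =>
    share (1 / ((t : ℝ) + 1)) (c i) (division ι s (v t) (y t))
  have hφ0 : ∀ t i j, 0 ≤ φ t i j := fun t i j => share_nonneg _ _ _ _
  have hφsum : ∀ t i, ∑ j, φ t i j = 1 := fun t i =>
    sum_share (hne i) (hdiv t) (by positivity)
  have hφ1 : ∀ t i j, φ t i j ≤ 1 := fun t i j => hφsum t i ▸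
    Finset.single_le_sum (f := φ t i) (fun j _ => hφ0 t i j) (Finset.mem_univ j)
  let U : Ultrafilter ℕ := hyperfilter ℕ
  have hU : (U : Filter ℕ) ≤ atTop := Nat.hyperfilter_le_atTop
  obtain ⟨u, huv⟩ : ∃ u, ∀ᶠ t in (U : Filter ℕ), v t = u := by
    have hfin : {u : List F | u.Nodup}.Finite :=
      Set.finite_coe_iff.1 (inferInstanceAs (Finite {u : List F // u.Nodup}))
    have : (⋃ u ∈ {u : List F | u.Nodup}, {t | v t = u}) ∈ U := by
      refine univ_mem' fun t => ?_
      simpa using hv t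
    obtain ⟨u, -, hu⟩ := (Ultrafilter.finite_biUnion_mem_iff hfin).1 this
    exact ⟨u, hu⟩
  obtain ⟨x, hx, hyx⟩ := (isCompact_stdSimplex ℝ F).ultrafilter_le_nhds (U.map y)
    (le_principal_iff.2 (Filter.mem_map.2 (univ_mem' hy)))
  obtain ⟨f, -, hφf⟩ := (isCompact_Icc (a := (0 : I → Fin q → ℝ)) (b := 1)).ultrafilter_le_nhds
    (U.map φ) (le_principal_iff.2 (Filter.mem_map.2
      (univ_mem' fun t => ⟨fun i j => hφ0 t i j, fun i j => hφ1 t i j⟩)))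
  have hf : ∀ i j, Tendsto (fun t => φ t i j) U (𝓝 (f i j)) := fun i j =>
    ((continuous_apply_apply i j).tendsto f).comp hφf
  obtain ⟨t₀, ht₀⟩ := huv.exists
  have hu : u.Nodup := ht₀ ▸ hv t₀
  have hallu : ∀ g, g ∈ u := ht₀ ▸ hall t₀
  have hrow : ∀ i, ∑ j, f i j = 1 := fun i =>
    tendsto_nhds_unique (tendsto_finsetSum _ fun j _ => hf i j) (by simp [hφsum])
  have hinv : Tendsto (fun t : ℕ => 1 / ((t : ℝ) + 1)) U (𝓝 0) :=
    tendsto_one_div_add_atTop_nhds_zero_nat.mono_left hU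
  have hle : ∀ j, (Fintype.card I : ℝ) / q ≤ ∑ i, f i j := fun j => by
    have h1 : Tendsto (fun t : ℕ => (Fintype.card I : ℝ) / q - 1 / ((t : ℝ) + 1)) U
        (𝓝 (Fintype.card I / q - 0)) := tendsto_const_nhds.sub hinv
    rw [sub_zero] at h1
    exact le_of_tendsto_of_tendsto' h1 (tendsto_finsetSum _ fun i _ => hf i j) fun t => hcol t j
  have hdu : ∀ x ∈ stdSimplex ℝ F, IsMultiDivision (division ι s u x) := fun x hx =>
    isMultiDivision_division hx hu fun g _ => hallu g
  refine ⟨u, hu, hallu, x, hx, f, fun i j => ge_of_tendsto' (hf i j) fun t => hφ0 t i j, hrow,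
    fun j => ?_, fun i j hij => ?_⟩
  · refine (((Finset.sum_eq_sum_iff_of_le (s := Finset.univ) fun j _ => hle j).1 ?_) j
      (Finset.mem_univ j)).symm
    rw [Finset.sum_comm]
    simp only [hrow, Finset.sum_const, Finset.card_univ, nsmul_eq_mul, Fintype.card_fin, mul_one]
    rw [mul_div_cancel₀ _ (by positivity)]
  · refine mem_of_prefDist_eq_zero (hc i) (hne i) (hcl i) (hdu x hx)
      (le_antisymm ?_ (prefDist_nonneg _ _ _))
    have hdist : Tendsto (fun t : ℕ => 1 / ((t : ℝ) + 1) +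
        q * (m * ((2 * u.length + 1) * dist x (y t)))) U (𝓝 0) := by
      have h1 : Tendsto (fun t => dist x (y t)) U (𝓝 0) := by
        have := (tendsto_const_nhds (x := x)).dist (show Tendsto y U (𝓝 x) from hyx)
        rwa [dist_self] at this
      simpa using hinv.add (((h1.const_mul _).const_mul _).const_mul _)
    refine ge_of_tendsto hdist ?_
    filter_upwards [huv, (hf i j).eventually (lt_mem_nhds hij)] with t htu hpos
    have h1 := prefDist_lt_of_share_pos hpos
    rw [htu] at h1
    have h2 := prefDist_le_add (hc i) (hne i) (hdu x hx) (hdu (y t) (hy t)) j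
    have h3 := multiDist_division_le (ι := ι) (s := s) (fun g => dist_le_pi_dist x (y t) g) u
    linarith

end Limit

section Loads

variable {q N : ℕ}

theorem card_filter_snoc {J : Type*} [DecidableEq J] (π : Fin N → J) (a j : J) :
    ({i | Fin.snoc (α := fun _ => J) π a i = j} : Finset (Fin (N + 1))).card =
      ({i | π i = j} : Finset (Fin N)).card + if a = j then 1 else 0 := by
  simp only [Finset.card_filter, Fin.sum_univ_castSucc, Fin.snoc_castSucc, Fin.snoc_last]

theorem eq_floor_or_eq_ceil {L : Fin q → ℕ} (hsum : ∑ j, L j = N + 1)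
    (hL : ∀ j, L j = N / q ∨ L j = N / q + 1) (j : Fin q) :
    (L j : ℤ) = ⌊((N + 1 : ℕ) : ℚ) / (q : ℚ)⌋ ∨ (L j : ℤ) = ⌈((N + 1 : ℕ) : ℚ) / (q : ℚ)⌉ := by
  have hq : 0 < q := Fin.pos j
  have hq' : (0 : ℚ) < q := by exact_mod_cast hq
  have hmod := Nat.div_add_mod' N q
  have hlt := Nat.mod_lt N hq
  rcases hL j with h | h <;> rw [h]
  · left
    have h1 : ∑ j, L j < ∑ _j : Fin q, (N / q + 1) :=
      Finset.sum_lt_sum (fun i _ => by rcases hL i with h | h <;> omega)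
        ⟨j, Finset.mem_univ j, by omega⟩
    rw [hsum, Finset.sum_const, Finset.card_univ, Fintype.card_fin, smul_eq_mul] at h1
    refine (Int.floor_eq_iff.2 ⟨?_, ?_⟩).symm
    · rw [le_div_iff₀ hq']
      exact_mod_cast (by omega : N / q * q ≤ N + 1)
    · rw [div_lt_iff₀ hq', mul_comm]
      exact_mod_cast h1
  · right
    refine (Int.ceil_eq_iff.2 ⟨?_, ?_⟩).symm
    · rw [lt_div_iff₀ hq']
      push_cast
      rw [add_sub_cancel_right]
      exact_mod_cast (by omega : N / q * q < N + 1)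
    · rw [div_le_iff₀ hq']
      exact_mod_cast (by rw [add_mul]; omega : N + 1 ≤ (N / q + 1) * q)

end Loads

end LayeredCake

/-- Theorem: envy-free division using `q−1` long knives. Let `m ≤ q ≤ n` with
`q = p^k` a prime power; `n` agents have closed preferences (given by choice functions `c i`,
nonempty on multi-divisions and invariant under permutations of the entries), agent `n` being
the birthday agent. Then there is a feasible and contiguous multi-division `A` into `q` layered
pieces, obtained by `q−1` long knives, such that for every `j*` there is an assignment
`π : [n] → [q]` with `π(n) = j*`, every non-birthday agent assigned a preferred layered piece,
and every piece assigned `⌊n/q⌋` or `⌈n/q⌉` agents. -/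
theorem stmt0 (m n q p k : ℕ) (hmq : m ≤ q) (hqn : q ≤ n)
    (hp : p.Prime) (hk : 0 < k) (hq : q = p ^ k)
    (c : Fin n → (Fin q → Fin m → Set ℝ) → Set (Fin q))
    (hne : ∀ i A, IsMultiDivision A → (c i A).Nonempty)
    (hperm : ∀ i (ρ : Equiv.Perm (Fin q)) (A : Fin q → Fin m → Set ℝ) (j : Fin q),
      j ∈ c i (fun j' => A (ρ j')) ↔ ρ j ∈ c i A)
    (hclosed : ∀ i (A : ℕ → Fin q → Fin m → Set ℝ) (B : Fin q → Fin m → Set ℝ),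
      (∀ t, IsMultiDivision (A t)) → IsMultiDivision B →
      (∀ j, Filter.Tendsto (fun t => layeredDist (A t j) (B j)) Filter.atTop (nhds 0)) →
      ∀ j, (∀ t, j ∈ c i (A t)) → j ∈ c i B) :
    ∃ A : Fin q → Fin m → Set ℝ,
      IsMultiDivision A ∧ (∀ j, IsContiguous (A j)) ∧ (∀ j, IsNonOverlapping (A j)) ∧
      IsLongKnifeDivision A ∧
      ∀ jstar : Fin q, ∃ π : Fin n → Fin q,
        π ⟨n - 1, by
          have h1 : 0 < q := by rw [hq]; exact pow_pos hp.pos k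
          omega⟩ = jstar ∧
        (∀ i : Fin n, (i : ℕ) < n - 1 → π i ∈ c i A) ∧
        (∀ j : Fin q,
          ((Finset.univ.filter fun i => π i = j).card : ℤ) = ⌊(n : ℚ) / (q : ℚ)⌋ ∨
          ((Finset.univ.filter fun i => π i = j).card : ℤ) = ⌈(n : ℚ) / (q : ℚ)⌉) := by
  obtain ⟨N, rfl⟩ : ∃ N, n = N + 1 :=
    Nat.exists_eq_add_of_le' ((hq ▸ pow_pos hp.pos k : 0 < q).trans_le hqn)
  classical
  have : Fact p.Prime := ⟨hp⟩
  have : Fintype (GaloisField p k) := Fintype.ofFinite _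
  let ι : Fin q ≃ GaloisField p k :=
    (Finite.equivFinOfCardEq ((GaloisField.card p k hk.ne').trans hq.symm)).symm
  let s : Fin m → GaloisField p k := fun ℓ => ι (Fin.castLE hmq ℓ)
  have hs : Function.Injective s := ι.injective.comp (Fin.castLE_injective hmq)
  obtain ⟨u, hu, hall, x, hx, f, hf, hrow, hcol, hmem⟩ :=
    LayeredCake.exists_division_fractional (ι := ι) (s := s) (p := p)
      (c := fun i : Fin N => c i.castSucc) (fun i => hperm _) (fun i => hne _) (fun i => hclosed _)
  refine ⟨LayeredCake.division ι s u x, LayeredCake.isMultiDivision_division hx hu fun g _ => hall g,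
    LayeredCake.isContiguous_division u x, LayeredCake.isNonOverlapping_division hs hall hx.1,
    LayeredCake.isLongKnifeDivision_division hx hu hall, fun jstar => ?_⟩
  obtain ⟨π, hpos, hstar, hload⟩ := LayeredCake.exists_balanced_assignment hf hrow
    (by simpa using hcol) jstar
  rw [Fintype.card_fin, Fintype.card_fin] at hstar
  simp only [Fintype.card_fin] at hload
  refine ⟨Fin.snoc (α := fun _ => Fin q) π jstar, Fin.snoc_last _ _, fun i hi => ?_,
    LayeredCake.eq_floor_or_eq_ceil ?_ fun j => ?_⟩
  · obtain ⟨i, rfl⟩ := Fin.exists_castSucc_eq.2 (Fin.ne_of_lt hi : i ≠ Fin.last N)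
    rw [Fin.snoc_castSucc]
    exact hmem i _ (hpos i)
  · rw [← Finset.card_eq_sum_card_fiberwise fun _ _ => Finset.mem_univ _]
    simp
  · rw [LayeredCake.card_filter_snoc]
    split_ifs with h
    · rw [← h, hstar]
      exact Or.inr rfl
    · exact hload j
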